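/- Let k/k₀ be a quadratic extension of finite fields of characteristic p, σ the nontrivial k₀-automorphism of k acting entrywise on GL_n(k), and R an algebraically closed field of characteristic 0. If n is odd, then there exists a σ-selfdual supercuspidal irreducible R-representation of GL_n(k). -/

import Mathlib

open Matrix

section InvariantForms

variable {R : Type} [CommRing R] {G : Type} [Monoid G] {V : Type} [AddCommGroup V] [Module R V]

/-- The space of `H`-invariant `R`-linear forms on a representation `ρ`. -/
def invariantForms (ρ : Representation R G V) (H : Set G) : Submodule R (V →ₗ[R] R) where
  carrier := {φ | ∀ g ∈ H, ∀ v : V, φ (ρ g v) = φ v}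
  add_mem' := by
    intro φ ψ hφ hψ g hg v
    simp only [LinearMap.add_apply, hφ g hg v, hψ g hg v]
  zero_mem' := by intro g hg v; simp
  smul_mem' := by
    intro c φ hφ g hg v
    simp only [LinearMap.smul_apply, hφ g hg v]

/-- A representation is irreducible if it is nonzero and its only invariant submodules
are `⊥` and `⊤`. -/
def IsIrreducibleRep (ρ : Representation R G V) : Prop :=
  (⊥ : Submodule R V) ≠ ⊤ ∧
    ∀ W : Submodule R V, (∀ g : G, ∀ v ∈ W, ρ g v ∈ W) → W = ⊥ ∨ W = ⊤

/-- Two representations are isomorphic if there is an equivariant linear equivalence. -/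
def RepIso {W : Type} [AddCommGroup W] [Module R W]
    (ρ : Representation R G V) (τ : Representation R G W) : Prop :=
  ∃ e : V ≃ₗ[R] W, ∀ (g : G) (v : V), e (ρ g v) = τ g (e v)

/-- `ρ` is (isomorphic to) a subquotient of `τ`:  there is a `τ`-invariant submodule `q`
together with an equivariant surjection from `q` onto the space of `ρ`. -/
def IsSubquotientOf {W : Type} [AddCommGroup W] [Module R W]
    (ρ : Representation R G V) (τ : Representation R G W) : Prop :=
  ∃ (q : Submodule R W) (hq : ∀ g : G, ∀ w ∈ q, τ g w ∈ q) (f : ↥q →ₗ[R] V),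
    Function.Surjective f ∧
      ∀ (g : G) (w : ↥q), f ⟨τ g w.1, hq g w.1 w.2⟩ = ρ g (f w)

end InvariantForms
section RightRegular

variable {R : Type} [CommRing R] {G : Type} [Group G] {V : Type} [AddCommGroup V] [Module R V]

/-- The right-translation representation of `G` on a translation-invariant submodule of
the space of `V`-valued functions on `G`. -/
def rightRegular (C : Submodule R (G → V))
    (hC : ∀ g : G, ∀ f ∈ C, (fun x => f (x * g)) ∈ C) :
    Representation R G ↥C where
  toFun g := LinearMap.restrict
    { toFun := fun (f : G → V) => (fun x => f (x * g))
      map_add' := fun _ _ => rfl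
      map_smul' := fun _ _ => by rfl } (fun f hf => hC g f hf)
  map_one' := by
    apply LinearMap.ext
    intro f
    apply Subtype.ext
    funext x
    simp [LinearMap.restrict_apply]
  map_mul' := by
    intro g g'
    apply LinearMap.ext
    intro f
    apply Subtype.ext
    funext x
    simp [LinearMap.restrict_apply, mul_assoc]

/-- The space of the representation of `G` induced from a representation `τ` of a
subgroup `P`. -/
def indCarrier {W : Type} [AddCommGroup W] [Module R W]
    (P : Subgroup G) (τ : Representation R ↥P W) : Submodule R (G → W) where
  carrier := {f | ∀ (p : ↥P) (g : G), f (↑p * g) = τ p (f g)}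
  add_mem' := by
    intro f₁ f₂ h₁ h₂ p g
    simp [h₁ p g, h₂ p g]
  zero_mem' := by intro p g; simp
  smul_mem' := by
    intro c f hf p g
    simp [hf p g]

/-- The representation of `G` induced from a representation `τ` of a subgroup `P`,
realized on functions `f : G → W` with `f (p * g) = τ p (f g)`, with `G` acting by right
translation. -/
def inducedRep {W : Type} [AddCommGroup W] [Module R W]
    (P : Subgroup G) (τ : Representation R ↥P W) :
    Representation R G ↥(indCarrier P τ) :=
  rightRegular (indCarrier P τ) (by
    intro g f hf p x
    simpa [mul_assoc] using hf p (x * g))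

end RightRegular
section GLdefs

variable (k₀ k : Type) [Field k₀] [Field k] [Algebra k₀ k]

/-- `GL n k₀` as a subgroup of `GL n k`:  the image of the entrywise inclusion. -/
def glBase (n : ℕ) : Subgroup (GL (Fin n) k) :=
  (Units.map ((algebraMap k₀ k).mapMatrix.toMonoidHom :
      Matrix (Fin n) (Fin n) k₀ →* Matrix (Fin n) (Fin n) k)).range

/-- The entrywise action of a field automorphism on `GL n k`. -/
def glAut (σ : k ≃ₐ[k₀] k) (n : ℕ) : GL (Fin n) k →* GL (Fin n) k :=
  Units.map (((σ : k →+* k).mapMatrix).toMonoidHom :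
      Matrix (Fin n) (Fin n) k →* Matrix (Fin n) (Fin n) k)

end GLdefs
section Parabolic

variable (k : Type) [Field k]

/-- The block upper-triangular parabolic subgroup of `GL n k` attached to a
block function `B`. -/
def parabolic (n r : ℕ) (B : Fin n → Fin r) : Subgroup (GL (Fin n) k) where
  carrier := {g | Matrix.BlockTriangular (g : Matrix (Fin n) (Fin n) k) B}
  one_mem' := by
    simpa using Matrix.blockTriangular_one (b := B)
  mul_mem' := by
    intro a b ha hb
    have h : ((a * b : GL (Fin n) k) : Matrix (Fin n) (Fin n) k)
        = (a : Matrix (Fin n) (Fin n) k) * (b : Matrix (Fin n) (Fin n) k) := rfl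
    simpa [Set.mem_setOf_eq, h] using Matrix.BlockTriangular.mul ha hb
  inv_mem' := by
    intro a ha
    have h : ((a⁻¹ : GL (Fin n) k) : Matrix (Fin n) (Fin n) k)
        = (a : Matrix (Fin n) (Fin n) k)⁻¹ := by
      simp [Matrix.coe_units_inv]
    haveI : Invertible (a : Matrix (Fin n) (Fin n) k) := a.invertible
    simpa [Set.mem_setOf_eq, h] using Matrix.blockTriangular_inv_of_blockTriangular ha

/-- A representation of `GL n k` is supercuspidal if it does not occur as a subquotient of
any representation induced from a proper parabolic subgroup, from a representation inflated
from the corresponding block-diagonal Levi subgroup (i.e. trivial on the unipotent radical). -/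
def IsSupercuspidal {R : Type} [CommRing R] {n : ℕ} {V : Type} [AddCommGroup V] [Module R V]
    (ρ : Representation R (GL (Fin n) k) V) : Prop :=
  ∀ (r : ℕ), 2 ≤ r → ∀ B : Fin n → Fin r, Monotone B → Function.Surjective B →
    ∀ (W : Type) [AddCommGroup W] [Module R W],
      ∀ τ : Representation R ↥(parabolic k n r B) W,
        (∀ u : ↥(parabolic k n r B),
            (∀ i j : Fin n, B i = B j →
              ((u : GL (Fin n) k) : Matrix (Fin n) (Fin n) k) i j
                = (1 : Matrix (Fin n) (Fin n) k) i j) → τ u = 1) →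
        ¬ IsSubquotientOf ρ (inducedRep (parabolic k n r B) τ)

/-- A representation of `GL n k` is cuspidal if it has no nonzero vector invariant under the
unipotent radical of a proper (maximal) parabolic subgroup. -/
def IsCuspidal {R : Type} [CommRing R] {n : ℕ} {V : Type} [AddCommGroup V] [Module R V]
    (ρ : Representation R (GL (Fin n) k) V) : Prop :=
  ∀ a b : ℕ, 0 < a → 0 < b → a + b = n →
    ∀ v : V,
      (∀ g : GL (Fin n) k,
        (∀ i j : Fin n, ¬((i : ℕ) < a ∧ a ≤ (j : ℕ)) →
          (g : Matrix (Fin n) (Fin n) k) i j = (1 : Matrix (Fin n) (Fin n) k) i j) →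
        ρ g v = v) → v = 0

end Parabolic

namespace GroupAverage

variable (R : Type) [Field R] {G : Type} [Group G] [Finite G]

/-- The averaging element of a subgroup in the group algebra. -/
noncomputable def avg (S : Subgroup G) : MonoidAlgebra R G :=
  let _ := Fintype.ofFinite S
  (Nat.card S : R)⁻¹ • ∑ s : S, MonoidAlgebra.of R G (s : G)

variable {R}

theorem of_mul_avg (S : Subgroup G) {s : G} (hs : s ∈ S) :
    MonoidAlgebra.of R G s * avg R S = avg R S := by
  let _ := Fintype.ofFinite S
  unfold avg
  rw [mul_smul_comm, Finset.mul_sum]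
  congr 1
  refine Fintype.sum_equiv (Equiv.mulLeft (⟨s, hs⟩ : S)) _ _ fun x => ?_
  rw [← map_mul]; rfl

theorem avg_mul_of (S : Subgroup G) {s : G} (hs : s ∈ S) :
    avg R S * MonoidAlgebra.of R G s = avg R S := by
  let _ := Fintype.ofFinite S
  unfold avg
  rw [smul_mul_assoc, Finset.sum_mul]
  congr 1
  refine Fintype.sum_equiv (Equiv.mulRight (⟨s, hs⟩ : S)) _ _ fun x => ?_
  rw [← map_mul]; rfl

theorem of_mul_avg_mul_of (S T : Subgroup G) (g : G) (h : ∀ x, g * x * g⁻¹ ∈ T ↔ x ∈ S) :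
    MonoidAlgebra.of R G g * avg R S = avg R T * MonoidAlgebra.of R G g := by
  let _ := Fintype.ofFinite S
  let _ := Fintype.ofFinite T
  let e : S ≃ T :=
    { toFun := fun x => ⟨g * x * g⁻¹, (h x).2 x.2⟩
      invFun := fun y => ⟨g⁻¹ * y * g, (h _).1 (by simp [mul_assoc])⟩
      left_inv := fun x => by simp [mul_assoc]
      right_inv := fun x => by simp [mul_assoc] }
  unfold avg
  rw [mul_smul_comm, smul_mul_assoc, Finset.mul_sum, Finset.sum_mul, Nat.card_congr e]
  congr 1
  refine Fintype.sum_equiv e _ _ fun x => ?_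
  rw [← map_mul, ← map_mul]
  simp [e]

/-- A linear map sees `y * avg S * z` only through the elements of `S`. -/
theorem map_mul_avg_mul_eq {M : Type} [AddCommGroup M] [Module R M] [CharZero R]
    (F : MonoidAlgebra R G →ₗ[R] M)
    (S : Subgroup G) (y z : MonoidAlgebra R G) (m : M)
    (h : ∀ s ∈ S, F (y * MonoidAlgebra.of R G s * z) = m) : F (y * avg R S * z) = m := by
  let _ := Fintype.ofFinite S
  unfold avg
  rw [mul_smul_comm, smul_mul_assoc, Finset.mul_sum, Finset.sum_mul, map_smul, map_sum,
    Finset.sum_congr rfl (fun (s : S) _ => h s s.2), Finset.sum_const, Finset.card_univ,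
    ← Nat.card_eq_fintype_card, ← Nat.cast_smul_eq_nsmul R, smul_smul, inv_mul_cancel₀, one_smul]
  exact_mod_cast Nat.card_pos.ne'

variable [CharZero R]

theorem avg_mul_avg_of_le {S T : Subgroup G} (h : S ≤ T) : avg R S * avg R T = avg R T := by
  have := map_mul_avg_mul_eq (LinearMap.id (R := R)) S 1 (avg R T) (avg R T)
    (fun s hs => by simpa using of_mul_avg (R := R) T (h hs))
  simpa using this

theorem avg_mul_self (S : Subgroup G) : avg R S * avg R S = avg R S := avg_mul_avg_of_le le_rfl

theorem avg_mul_avg_mul_avg {A B C : Subgroup G} (h : ∀ c ∈ C, ∃ a ∈ A, ∃ b ∈ B, c = a * b) :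
    avg R A * avg R C * avg R B = avg R A * avg R B := by
  refine map_mul_avg_mul_eq (LinearMap.id (R := R)) C _ _ _ fun c hc => ?_
  obtain ⟨a, ha, b, hb, rfl⟩ := h c hc
  rw [LinearMap.id_apply, map_mul, ← mul_assoc, avg_mul_of A ha, mul_assoc, of_mul_avg B hb]

end GroupAverage

/-- A splitting of an algebra as a product of matrix algebras. -/
structure MatrixSplitting (R : Type) [Field R] (A : Type) [Ring A] [Algebra R A] where
  /-- the number of factors -/
  num : ℕ
  /-- the sizes of the factors -/
  size : Fin num → ℕ
  size_ne : ∀ i, NeZero (size i)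
  /-- the isomorphism with the product -/
  equiv : A ≃ₐ[R] Π i, Matrix (Fin (size i)) (Fin (size i)) R

namespace MatrixSplitting

variable {R : Type} [Field R]

theorem nonempty_monoidAlgebra [IsAlgClosed R] [CharZero R] (G : Type) [Group G] [Finite G] :
    Nonempty (MatrixSplitting R (MonoidAlgebra R G)) := by
  have : NeZero (Nat.card G : R) := ⟨by exact_mod_cast Nat.card_pos.ne'⟩
  obtain ⟨n, d, hd, ⟨e⟩⟩ := IsSemisimpleRing.exists_algEquiv_pi_matrix_of_isAlgClosed R
    (MonoidAlgebra R G)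
  exact ⟨⟨n, d, hd, e⟩⟩

variable {A : Type} [Ring A] [Algebra R A] (S : MatrixSplitting R A)

/-- The irreducible matrix representations. -/
def rep (i : Fin S.num) : A →ₐ[R] Matrix (Fin (S.size i)) (Fin (S.size i)) R :=
  (Pi.evalAlgHom R (fun i => Matrix (Fin (S.size i)) (Fin (S.size i)) R) i).comp
    (S.equiv : A →ₐ[R] _)

/-- The irreducible characters. -/
def chi (i : Fin S.num) : A →ₗ[R] R :=
  (Matrix.traceLinearMap (Fin (S.size i)) R R) ∘ₗ (S.rep i).toLinearMap

theorem chi_apply (i : Fin S.num) (a : A) : S.chi i a = (S.rep i a).trace := rfl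

theorem chi_mul_comm (i : Fin S.num) (a b : A) : S.chi i (a * b) = S.chi i (b * a) := by
  rw [chi_apply, chi_apply, map_mul, map_mul, Matrix.trace_mul_comm]

/-- The element acting by `m` in the `i`-th representation and by `0` in the others. -/
noncomputable def lift (i : Fin S.num) (m : Matrix (Fin (S.size i)) (Fin (S.size i)) R) : A :=
  S.equiv.symm (Pi.single i m)

theorem rep_lift (i : Fin S.num) (m) : S.rep i (S.lift i m) = m := by
  simp [rep, lift]

theorem rep_lift_of_ne {i j : Fin S.num} (h : j ≠ i) (m) : S.rep j (S.lift i m) = 0 := by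
  simp [rep, lift, h]

theorem ext_rep {a b : A} (h : ∀ i, S.rep i a = S.rep i b) : a = b :=
  S.equiv.injective (funext h)

theorem rep_surjective (i : Fin S.num) : Function.Surjective (S.rep i) :=
  fun m => ⟨_, S.rep_lift i m⟩

theorem lift_mul (i : Fin S.num) (m) (a : A) : S.lift i m * a = S.lift i (m * S.rep i a) := by
  refine S.ext_rep fun j => ?_
  by_cases h : j = i
  · subst h; rw [map_mul, rep_lift, rep_lift]
  · rw [map_mul, rep_lift_of_ne _ h, rep_lift_of_ne _ h, zero_mul]

theorem mul_lift (i : Fin S.num) (m) (a : A) : a * S.lift i m = S.lift i (S.rep i a * m) := by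
  refine S.ext_rep fun j => ?_
  by_cases h : j = i
  · subst h; rw [map_mul, rep_lift, rep_lift]
  · rw [map_mul, rep_lift_of_ne _ h, rep_lift_of_ne _ h, mul_zero]

theorem lift_add (i : Fin S.num) (m m') : S.lift i (m + m') = S.lift i m + S.lift i m' := by
  simp [lift, Pi.single_add]

theorem lift_smul (i : Fin S.num) (c : R) (m) : S.lift i (c • m) = c • S.lift i m := by
  simp [lift, Pi.single_smul]

theorem sum_lift_one : ∑ i, S.lift i 1 = 1 := by
  refine S.ext_rep fun j => ?_
  rw [map_sum, Finset.sum_eq_single j (fun i _ h => S.rep_lift_of_ne h.symm _) (by simp),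
    rep_lift, map_one]

/-- A trace form on a matrix algebra is a multiple of the trace. -/
theorem exists_eq_mul_trace {n : ℕ} [NeZero n] (F : Matrix (Fin n) (Fin n) R →ₗ[R] R)
    (hF : ∀ a b, F (a * b) = F (b * a)) : ∃ c, ∀ m, F m = c * m.trace := by
  have h0 : ∀ i j, i ≠ j → F (Matrix.single i j 1) = 0 := fun i j h => by
    have := hF (Matrix.single i i 1) (Matrix.single i j 1)
    rwa [Matrix.single_mul_single_same, Matrix.single_mul_single_of_ne _ _ _ _ h.symm,
      map_zero, one_mul] at this
  have h1 : ∀ i, F (Matrix.single i i 1) = F (Matrix.single 0 0 1) := fun i => by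
    have := hF (Matrix.single i 0 1) (Matrix.single 0 i 1)
    rwa [Matrix.single_mul_single_same, Matrix.single_mul_single_same, one_mul] at this
  refine ⟨F (Matrix.single 0 0 1), fun m => ?_⟩
  conv_lhs => rw [Matrix.matrix_eq_sum_single m]
  have h2 : ∀ i j, F (Matrix.single i j (m i j)) = m i j * F (Matrix.single i j 1) := fun i j => by
    rw [← smul_eq_mul, ← map_smul, Matrix.smul_single, smul_eq_mul, mul_one]
  rw [map_sum, Matrix.trace, Finset.mul_sum]
  refine Finset.sum_congr rfl fun i _ => ?_
  rw [map_sum, Finset.sum_eq_single i (fun j _ h => by rw [h2, h0 i j h.symm, mul_zero]) (by simp),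
    h2, h1, mul_comm, Matrix.diag_apply]

theorem exists_eq_mul_chi (i : Fin S.num) (F : A →ₗ[R] R) (hF : ∀ a b, F (a * b) = F (b * a)) :
    ∃ c, ∀ a, F (a * S.lift i 1) = c * S.chi i a := by
  have := S.size_ne i
  obtain ⟨c, hc⟩ := exists_eq_mul_trace (n := S.size i)
    (F ∘ₗ { toFun := S.lift i, map_add' := S.lift_add i, map_smul' := S.lift_smul i })
    (fun a b => by
      have : ∀ a b, S.lift i (a * b) = S.lift i a * S.lift i b := fun a b => by
        rw [lift_mul, rep_lift]
      simp [this, hF (S.lift i a)])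
  refine ⟨c, fun a => ?_⟩
  rw [mul_lift, mul_one, chi_apply, ← hc]; rfl

theorem chi_natCast [CharZero R] (i : Fin S.num) {e : A} (he : e * e = e) :
    (∃ m : ℕ, S.chi i e = m) ∧ (S.chi i e = 0 → S.rep i e = 0) := by
  have h : IsIdempotentElem (Matrix.toLin' (S.rep i e)) := by
    rw [IsIdempotentElem, Module.End.mul_eq_comp, ← Matrix.toLin'_mul, ← map_mul, he]
  have ht : S.chi i e = LinearMap.trace R _ (Matrix.toLin' (S.rep i e)) := by
    rw [Matrix.trace_toLin'_eq, chi_apply]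
  refine ⟨⟨_, ht.trans (LinearMap.IsIdempotentElem.isProj_range _ h).trace⟩, fun h0 => ?_⟩
  rw [ht, LinearMap.IsIdempotentElem.trace_eq_zero_iff h] at h0
  simpa using h0

theorem sum_chi_mul_chi (x y : A) :
    ∑ i, S.chi i x * S.chi i y =
      LinearMap.trace R A (LinearMap.mulLeft R x ∘ₗ LinearMap.mulRight R y) := by
  let b := (Pi.basis (fun i => Matrix.stdBasis R (Fin (S.size i)) (Fin (S.size i)))).map
    S.equiv.symm.toLinearEquiv
  rw [LinearMap.trace_eq_matrix_trace R b, Matrix.trace, Fintype.sum_sigma]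
  refine Finset.sum_congr rfl fun i _ => ?_
  rw [chi_apply, chi_apply, Matrix.trace, Matrix.trace, Finset.sum_mul_sum,
    Fintype.sum_prod_type]
  refine Finset.sum_congr rfl fun s _ => Finset.sum_congr rfl fun t _ => ?_
  rw [Matrix.diag_apply, Matrix.diag_apply, Matrix.diag_apply, LinearMap.toMatrix_apply]
  have hb : b ⟨i, (s, t)⟩ = S.lift i (Matrix.single s t 1) := by
    simp [b, lift, Pi.basis_apply, Matrix.stdBasis_eq_single]
  rw [hb]
  have : (LinearMap.mulLeft R x ∘ₗ LinearMap.mulRight R y) (S.lift i (Matrix.single s t 1))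
      = S.lift i (S.rep i x * Matrix.single s t 1 * S.rep i y) := by
    simp [lift_mul, mul_lift, mul_assoc]
  rw [this]
  have h2 : b.repr (S.lift i (S.rep i x * Matrix.single s t 1 * S.rep i y)) ⟨i, (s, t)⟩ =
      (S.rep i x * Matrix.single s t 1 * S.rep i y :
        Matrix (Fin (S.size i)) (Fin (S.size i)) R) s t := by
    simp [b, lift, Matrix.stdBasis]
  rw [h2, Matrix.mul_apply, Finset.sum_eq_single t]
  · simp
  · intro j _ hj
    rw [Matrix.mul_single_apply_of_ne _ _ _ _ _ hj, zero_mul]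
  · simp

theorem sum_chi_of_mul_chi_of {G : Type} [Group G] [Finite G]
    (S : MatrixSplitting R (MonoidAlgebra R G)) (g h : G) :
    ∑ i, S.chi i (MonoidAlgebra.of R G g) * S.chi i (MonoidAlgebra.of R G h) =
      (Nat.card {z : G // g * z * h = z} : R) := by
  classical
  let _ := Fintype.ofFinite G
  let b : Module.Basis G R (MonoidAlgebra R G) := ⟨MonoidAlgebra.coeffLinearEquiv R⟩
  have hb : ∀ z, b z = MonoidAlgebra.of R G z := fun z => by
    apply b.repr.injective; simp [b]
  rw [sum_chi_mul_chi, LinearMap.trace_eq_matrix_trace R b, Matrix.trace,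
    Nat.card_eq_fintype_card, Fintype.card_subtype, Finset.card_filter, Nat.cast_sum]
  refine Finset.sum_congr rfl fun z _ => ?_
  rw [Matrix.diag_apply, LinearMap.toMatrix_apply, hb]
  have : (LinearMap.mulLeft R (MonoidAlgebra.of R G g) ∘ₗ
      LinearMap.mulRight R (MonoidAlgebra.of R G h)) (MonoidAlgebra.of R G z) =
      b (g * z * h) := by
    rw [hb]; simp [mul_assoc]
  rw [this, b.repr_self, Finsupp.single_apply]
  simp

/-- Every irreducible matrix representation is one of the factors. -/
theorem exists_equiv {m : ℕ} [NeZero m] (ψ : A →ₐ[R] Matrix (Fin m) (Fin m) R)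
    (hψ : Function.Surjective ψ) :
    ∃ i, ∃ P : (Fin (S.size i) → R) ≃ₗ[R] (Fin m → R),
      ∀ a w, P (S.rep i a *ᵥ w) = ψ a *ᵥ P w := by
  have h1 : ∃ i, ψ (S.lift i 1) ≠ 0 := by
    by_contra! h
    have := congrArg ψ S.sum_lift_one
    rw [map_sum, Finset.sum_congr rfl (fun i _ => h i), map_one] at this
    simp at this
  obtain ⟨i, hi⟩ := h1
  have := S.size_ne i
  have h2 : ∃ w v, ψ (S.lift i (Matrix.vecMulVec w (Pi.single 0 1))) *ᵥ v ≠ 0 := by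
    by_contra! h
    apply hi
    have h3 : ∀ w, ψ (S.lift i (Matrix.vecMulVec w (Pi.single 0 1))) = 0 := fun w =>
      Matrix.toLin'.injective (LinearMap.ext fun v => by simpa using h w v)
    have h4 : (1 : Matrix (Fin (S.size i)) (Fin (S.size i)) R) =
        ∑ s, Matrix.vecMulVec (Pi.single s 1) (Pi.single 0 1) *
          Matrix.vecMulVec (Pi.single 0 1) (Pi.single s 1) := by
      simp only [← Matrix.single_eq_single_vecMulVec_single, Matrix.single_mul_single_same]
      conv_lhs => rw [Matrix.matrix_eq_sum_single 1]
      refine Finset.sum_congr rfl fun s _ => ?_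
      rw [Finset.sum_eq_single s]
      · simp
      · intro t _ ht; rw [Matrix.one_apply_ne ht.symm, Matrix.single_zero]
      · simp
    have h5 : S.lift i 1 = ∑ s, S.lift i (Matrix.vecMulVec (Pi.single s 1) (Pi.single 0 1)) *
        S.lift i (Matrix.vecMulVec (Pi.single 0 1) (Pi.single s 1)) := by
      refine S.ext_rep fun j => ?_
      rw [map_sum]
      by_cases hj : j = i
      · subst hj
        simp only [map_mul, rep_lift]
        exact h4
      · simp [rep_lift_of_ne _ hj]
    rw [h5, map_sum]
    exact Finset.sum_eq_zero fun s _ => by rw [map_mul, h3, zero_mul]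
  obtain ⟨w₀, v, hwv⟩ := h2
  let P : (Fin (S.size i) → R) →ₗ[R] (Fin m → R) :=
    { toFun := fun w => ψ (S.lift i (Matrix.vecMulVec w (Pi.single 0 1))) *ᵥ v
      map_add' := fun a b => by
        rw [Matrix.add_vecMulVec, lift_add, map_add, Matrix.add_mulVec]
      map_smul' := fun c a => by
        rw [Matrix.smul_vecMulVec, lift_smul, map_smul, Matrix.smul_mulVec, RingHom.id_apply] }
  have hP : ∀ a w, P (S.rep i a *ᵥ w) = ψ a *ᵥ P w := fun a w => by
    change ψ _ *ᵥ v = ψ a *ᵥ (ψ _ *ᵥ v)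
    rw [Matrix.mulVec_mulVec, ← map_mul, mul_lift, Matrix.mul_vecMulVec]
  have key : ∀ {q : ℕ} (x y : Fin q → R), x ≠ 0 → ∃ M : Matrix (Fin q) (Fin q) R, M *ᵥ x = y := by
    intro q x y hx
    obtain ⟨j, hj⟩ := Function.ne_iff.1 hx
    refine ⟨Matrix.vecMulVec ((x j)⁻¹ • y) (Pi.single j 1), ?_⟩
    rw [Matrix.vecMulVec_mulVec]
    ext t
    simp at hj
    simp [hj, mul_comm]
  refine ⟨i, LinearEquiv.ofBijective P ⟨?_, ?_⟩, hP⟩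
  · rw [← LinearMap.ker_eq_bot, LinearMap.ker_eq_bot']
    intro w hw
    by_contra hne
    obtain ⟨M, hM⟩ := key w w₀ hne
    obtain ⟨a, rfl⟩ := S.rep_surjective i M
    apply hwv
    change P w₀ = 0
    rw [← hM, hP, hw, Matrix.mulVec_zero]
  · intro y
    obtain ⟨M, hM⟩ := key (P w₀) y hwv
    obtain ⟨a, rfl⟩ := hψ M
    exact ⟨S.rep i a *ᵥ w₀, by rw [hP, hM]⟩

theorem trace_eq_chi {m : ℕ} (ψ : A →ₐ[R] Matrix (Fin m) (Fin m) R) (i : Fin S.num)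
    (P : (Fin (S.size i) → R) ≃ₗ[R] (Fin m → R))
    (hP : ∀ a w, P (S.rep i a *ᵥ w) = ψ a *ᵥ P w) (a : A) : (ψ a).trace = S.chi i a := by
  rw [chi_apply, ← Matrix.trace_toLin'_eq, ← Matrix.trace_toLin'_eq,
    ← LinearMap.trace_conj' (Matrix.toLin' (S.rep i a)) P]
  congr 1
  refine LinearMap.ext fun y => ?_
  simp [LinearEquiv.conj_apply, hP]

end MatrixSplitting

namespace Parahoric

variable {k V : Type} [Field k] [AddCommGroup V] [Module k V]

/-- The `i`-th partial sum `L + g L + ⋯ + g ^ (i - 1) L`. -/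
def chain (L : Submodule k V) (g : V ≃ₗ[k] V) : ℕ → Submodule k V
  | 0 => ⊥
  | i + 1 => L ⊔ (chain L g i).map (g : V →ₗ[k] V)

variable (L : Submodule k V) (g : V ≃ₗ[k] V)

theorem chain_zero : chain L g 0 = ⊥ := rfl

theorem chain_succ (i : ℕ) : chain L g (i + 1) = L ⊔ (chain L g i).map (g : V →ₗ[k] V) := rfl

theorem chain_one : chain L g 1 = L := by simp [chain]

theorem chain_le_succ (i : ℕ) : chain L g i ≤ chain L g (i + 1) := by
  induction i with
  | zero => exact bot_le
  | succ i ih => exact sup_le_sup_left (Submodule.map_mono ih) L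

theorem chain_mono : Monotone (chain L g) := monotone_nat_of_le_succ (chain_le_succ L g)

theorem le_chain {i : ℕ} (hi : 1 ≤ i) : L ≤ chain L g i := by
  simpa only [chain_one] using chain_mono L g hi

theorem map_chain_le (i : ℕ) : (chain L g i).map (g : V →ₗ[k] V) ≤ chain L g (i + 1) :=
  le_sup_right

theorem apply_mem_chain {i : ℕ} {v : V} (h : v ∈ chain L g i) : g v ∈ chain L g (i + 1) :=
  map_chain_le L g i (Submodule.mem_map_of_mem h)

/-- The submonoid of automorphisms acting trivially on the successive quotients of a filtration. -/
def flagMonoid (F : ℕ →o Submodule k V) (j : ℕ) : Submonoid (V ≃ₗ[k] V) where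
  carrier := {u | (∀ v, u v - v ∈ F j) ∧ ∀ i < j, ∀ v ∈ F (i + 1), u v - v ∈ F i}
  one_mem' := by simp
  mul_mem' := by
    rintro a b ⟨ha, ha'⟩ ⟨hb, hb'⟩
    have e : ∀ v, (a * b) v - v = (a (b v) - b v) + (b v - v) := fun v => by
      simp
    refine ⟨fun v => ?_, fun i hi v hv => ?_⟩
    · rw [e]; exact add_mem (ha _) (hb _)
    · rw [e]
      refine add_mem (ha' i hi _ ?_) (hb' i hi v hv)
      have := add_mem (F.monotone (Nat.le_succ i) (hb' i hi v hv)) hv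
      simpa using this

/-- The subgroup underlying a submonoid of a finite group. -/
def groupOfMonoid {G : Type} [Group G] [Finite G] (M : Submonoid G) : Subgroup G where
  toSubmonoid := M
  inv_mem' := by
    intro x hx
    have : x⁻¹ = x ^ (orderOf x - 1) := by
      rw [inv_eq_iff_mul_eq_one, ← pow_succ', Nat.sub_add_cancel (orderOf_pos x),
        pow_orderOf_eq_one]
    change x⁻¹ ∈ M
    rw [this]
    exact pow_mem hx _

/-- The group of automorphisms acting trivially on the successive quotients of a filtration. -/
def flagGroup [Finite (V ≃ₗ[k] V)] (F : ℕ →o Submodule k V) (j : ℕ) : Subgroup (V ≃ₗ[k] V) :=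
  groupOfMonoid (flagMonoid F j)

/-- The automorphism `1 + X` for `X` of square zero. -/
def onePlus (X : V →ₗ[k] V) (h : ∀ v, X (X v) = 0) : V ≃ₗ[k] V :=
  LinearEquiv.ofLinearMap (LinearMap.id + X) (LinearMap.id - X)
    (LinearMap.ext fun v => by simp [h]) (LinearMap.ext fun v => by simp [h])

theorem onePlus_apply (X : V →ₗ[k] V) (h : ∀ v, X (X v) = 0) (v : V) :
    onePlus X h v = v + X v := rfl

theorem onePlus_inv_apply (X : V →ₗ[k] V) (h : ∀ v, X (X v) = 0) (v : V) :
    (onePlus X h)⁻¹ v = v - X v := rfl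

theorem exists_proj_mod (X Y : Submodule k V) :
    ∃ P : V →ₗ[k] V, (∀ v, P v ∈ Y) ∧ ∀ v ∈ X ⊔ Y, v - P v ∈ X := by
  obtain ⟨s, hs⟩ := LinearMap.exists_rightInverse_of_surjective
    ((X.mkQ.comp Y.subtype).rangeRestrict) (LinearMap.range_rangeRestrict _)
  obtain ⟨t, ht⟩ := LinearMap.exists_extend s
  refine ⟨Y.subtype ∘ₗ t ∘ₗ X.mkQ, fun v => by simp, fun v hv => ?_⟩
  obtain ⟨x, hx, y, hy, rfl⟩ := Submodule.mem_sup.1 hv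
  have hq : X.mkQ (x + y) = X.mkQ y := by
    rw [map_add]; simp [hx]
  let z : LinearMap.range (X.mkQ.comp Y.subtype) := ⟨X.mkQ y, ⟨⟨y, hy⟩, rfl⟩⟩
  have h1 : t (X.mkQ y) = s z := LinearMap.congr_fun ht z
  have h2 := congrArg Subtype.val (LinearMap.congr_fun hs z)
  have h3 : X.mkQ ((s z : Y) : V) = X.mkQ y := h2
  rw [← Submodule.Quotient.mk_eq_zero, ← Submodule.mkQ_apply, map_sub, sub_eq_zero, hq, ← h3, ← h1,
    ← hq]
  rfl

variable [Finite (V ≃ₗ[k] V)]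

/-- The unipotent radical of the stabiliser of `L`. -/
def unip : Subgroup (V ≃ₗ[k] V) :=
  flagGroup ⟨fun i => if i = 0 then ⊥ else L, by
    intro i j h
    by_cases hi : i = 0
    · simp [hi]
    · have : j ≠ 0 := by omega
      simp [hi, this]⟩ 1

theorem mem_unip {L : Submodule k V} {u : V ≃ₗ[k] V} :
    u ∈ unip L ↔ (∀ v, u v - v ∈ L) ∧ ∀ v ∈ L, u v = v := by
  have h : u ∈ unip L ↔ (∀ v, u v - v ∈ L) ∧
      ∀ i < 1, ∀ v ∈ (if i + 1 = 0 then ⊥ else L), u v - v ∈ (if i = 0 then ⊥ else L) := Iff.rfl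
  rw [h]
  simp [sub_eq_zero]

/-- The group attached to the filtration `chain L g`. -/
def chainGroup (j : ℕ) : Subgroup (V ≃ₗ[k] V) :=
  flagGroup ⟨chain L g, chain_mono L g⟩ j

variable {L g}

theorem mem_chainGroup {j : ℕ} {u : V ≃ₗ[k] V} :
    u ∈ chainGroup L g j ↔ (∀ v, u v - v ∈ chain L g j) ∧
      ∀ i < j, ∀ v ∈ chain L g (i + 1), u v - v ∈ chain L g i :=
  Iff.rfl

theorem chainGroup_one : chainGroup L g 1 = unip L := by
  ext u
  simp [mem_chainGroup, mem_unip, chain_one, chain_zero, sub_eq_zero]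

theorem mem_conj_chainGroup {j : ℕ} {u : V ≃ₗ[k] V}
    (h1 : ∀ v, u v - v ∈ (chain L g j).map (g : V →ₗ[k] V))
    (h2 : ∀ i < j, ∀ v ∈ (chain L g (i + 1)).map (g : V →ₗ[k] V),
      u v - v ∈ (chain L g i).map (g : V →ₗ[k] V)) :
    u ∈ (chainGroup L g j).map (MulAut.conj g).toMonoidHom := by
  refine ⟨g⁻¹ * u * g, ?_, by simp [mul_assoc]⟩
  have e : ∀ v, (g⁻¹ * u * g) v - v = g.symm (u (g v) - g v) := fun v => by
    rw [map_sub, LinearEquiv.symm_apply_apply]; rfl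
  have m : ∀ {X : Submodule k V} {v}, v ∈ X.map (g : V →ₗ[k] V) → g.symm v ∈ X := by
    rintro X _ ⟨v, hv, rfl⟩; simpa using hv
  refine mem_chainGroup.2 ⟨fun v => ?_, fun i hi v hv => ?_⟩
  · rw [e]; exact m (h1 _)
  · rw [e]; exact m (h2 i hi _ (Submodule.mem_map_of_mem hv))

theorem exists_mul_of_mem_chainGroup_succ {j : ℕ} (hj : 1 ≤ j) {u : V ≃ₗ[k] V}
    (hu : u ∈ chainGroup L g (j + 1)) :
    ∃ a ∈ chainGroup L g j, ∃ b ∈ (chainGroup L g j).map (MulAut.conj g).toMonoidHom,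
      u = a * b := by
  obtain ⟨hu1, hu2⟩ := mem_chainGroup.1 hu
  obtain ⟨P, hP1, hP2⟩ := exists_proj_mod (chain L g j) ((chain L g j).map (g : V →ₗ[k] V))
  obtain ⟨r, hr⟩ := LinearMap.exists_leftInverse_of_injective (chain L g (j + 1)).subtype
    (Submodule.ker_subtype _)
  let Q : V →ₗ[k] V := LinearMap.id - (chain L g (j + 1)).subtype ∘ₗ r
  have hQ0 : ∀ v ∈ chain L g (j + 1), Q v = 0 := fun v hv => by
    have : r v = ⟨v, hv⟩ := LinearMap.congr_fun hr ⟨v, hv⟩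
    simp [Q, this]
  have hQ1 : ∀ v, v - Q v ∈ chain L g (j + 1) := fun v => by simp [Q]
  let A : V →ₗ[k] V := P ∘ₗ ((u : V →ₗ[k] V) - LinearMap.id) ∘ₗ Q
  have hA0 : ∀ v ∈ chain L g (j + 1), A v = 0 := fun v hv => by simp [A, hQ0 v hv]
  have hA1 : ∀ v, A v ∈ (chain L g j).map (g : V →ₗ[k] V) := fun v => hP1 _
  have hA1' : ∀ v, A v ∈ chain L g (j + 1) := fun v => map_chain_le L g j (hA1 v)
  have hle : chain L g (j + 1) ≤ chain L g j ⊔ (chain L g j).map (g : V →ₗ[k] V) :=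
    sup_le_sup_right (le_chain L g hj) _
  have hA2 : ∀ v, (u v - v) - A v ∈ chain L g j := fun v => by
    have h1 : (u (Q v) - Q v) - A v ∈ chain L g j := hP2 _ (hle (hu1 _))
    have h2 := hu2 j (Nat.lt_succ_self j) _ (hQ1 v)
    have := add_mem h1 h2
    rw [map_sub] at this
    convert this using 1
    abel
  have hAA : ∀ v, A (A v) = 0 := fun v => hA0 _ (hA1' v)
  refine ⟨u * (onePlus A hAA)⁻¹, ?_, onePlus A hAA, ?_, by simp⟩
  · have e : ∀ v, (u * (onePlus A hAA)⁻¹) v - v = ((u v - v) - A v) - (u (A v) - A v) := fun v => by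
      rw [LinearEquiv.mul_apply, onePlus_inv_apply, map_sub]; abel
    refine mem_chainGroup.2 ⟨fun v => ?_, fun i hi v hv => ?_⟩
    · rw [e]
      exact sub_mem (hA2 v) (hu2 j (Nat.lt_succ_self j) _ (hA1' v))
    · rw [e, hA0 v (chain_mono L g (by omega) hv)]
      simpa using hu2 i (by omega) v hv
  · refine mem_conj_chainGroup (fun v => ?_) fun i hi v hv => ?_
    · simpa [onePlus_apply] using hA1 v
    · rw [onePlus_apply, hA0 v (chain_mono L g (by omega) (map_chain_le L g _ hv))]
      simp

theorem chainGroup_le_succ (j : ℕ) : chainGroup L g j ≤ chainGroup L g (j + 1) := by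
  intro u hu
  obtain ⟨h1, h2⟩ := mem_chainGroup.1 hu
  refine mem_chainGroup.2 ⟨fun v => chain_le_succ L g j (h1 v), fun i hi v hv => ?_⟩
  rcases Nat.lt_succ_iff_lt_or_eq.1 hi with h | rfl
  · exact h2 i h v hv
  · exact h1 v

theorem exists_mul_of_mem_unip {j : ℕ} (hj : 1 ≤ j) {u : V ≃ₗ[k] V}
    (hu : u ∈ unip (L ⊓ (chain L g j).map (g : V →ₗ[k] V))) :
    ∃ a ∈ chainGroup L g j, ∃ b ∈ (chainGroup L g j).map (MulAut.conj g).toMonoidHom,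
      u = a * b := by
  obtain ⟨hu1, hu2⟩ := mem_unip.1 hu
  obtain ⟨P, hP1, hP2⟩ := exists_proj_mod L ((chain L g j).map (g : V →ₗ[k] V))
  set L0 := L ⊓ (chain L g j).map (g : V →ₗ[k] V) with hL0
  let X : V →ₗ[k] V := (u : V →ₗ[k] V) - LinearMap.id
  have hX : ∀ v, X v = u v - v := fun v => rfl
  have hX1 : ∀ v, X v ∈ L0 := hu1
  have hX0 : ∀ v ∈ L0, X v = 0 := fun v hv => by rw [hX, hu2 v hv, sub_self]
  have hPL : ∀ v ∈ L, P v ∈ L0 := fun v hv => by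
    refine ⟨?_, hP1 v⟩
    simpa using sub_mem hv (hP2 v (le_sup_left (a := L) hv))
  have hPY : ∀ v ∈ (chain L g j).map (g : V →ₗ[k] V), v - P v ∈ L0 := fun v hv =>
    ⟨hP2 v (le_sup_right (a := L) hv), sub_mem hv (hP1 v)⟩
  have ha : ∀ v, (X ∘ₗ P) ((X ∘ₗ P) v) = 0 := fun v => hX0 _ (hPL _ (hX1 _).1)
  have hb : ∀ v, (X - X ∘ₗ P) ((X - X ∘ₗ P) v) = 0 := fun v => by
    have h1 : (X - X ∘ₗ P) v ∈ L0 := sub_mem (hX1 _) (hX1 _)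
    rw [LinearMap.sub_apply, hX0 _ h1, LinearMap.comp_apply, hX0 _ (hPL _ h1.1), sub_self]
  refine ⟨onePlus _ ha, ?_, onePlus _ hb, ?_, ?_⟩
  · refine mem_chainGroup.2 ⟨fun v => ?_, fun i hi v hv => ?_⟩
    · simpa [onePlus_apply] using le_chain L g hj (hX1 (P v)).1
    · rw [onePlus_apply, add_sub_cancel_left]
      rcases Nat.eq_zero_or_pos i with rfl | h
      · rw [chain_one] at hv
        rw [LinearMap.comp_apply, hX0 _ (hPL v hv)]
        exact zero_mem _
      · exact le_chain L g h (hX1 _).1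
  · refine mem_conj_chainGroup (fun v => ?_) fun i hi v hv => ?_
    · rw [onePlus_apply, add_sub_cancel_left]
      exact (sub_mem (hX1 _) (hX1 _) : (X - X ∘ₗ P) v ∈ L0).2
    · have : v - P v ∈ L0 := hPY v (Submodule.map_mono (chain_mono L g hi) hv)
      have h2 := hX0 _ this
      rw [map_sub] at h2
      rw [onePlus_apply, add_sub_cancel_left, LinearMap.sub_apply, LinearMap.comp_apply, h2]
      exact zero_mem _
  · refine LinearEquiv.ext fun v => ?_
    rw [LinearEquiv.mul_apply, onePlus_apply, onePlus_apply]
    have h1 : (X - X ∘ₗ P) v ∈ L0 := sub_mem (hX1 _) (hX1 _)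
    have h2 : (X ∘ₗ P) (v + (X - X ∘ₗ P) v) = X (P v) := by
      rw [map_add, LinearMap.comp_apply, LinearMap.comp_apply, hX0 _ (hPL _ h1.1), add_zero]
    rw [h2, LinearMap.sub_apply, LinearMap.comp_apply, hX]
    abel

end Parahoric

namespace Parahoric

variable {k V : Type} [Field k] [AddCommGroup V] [Module k V]

instance finite_linearEquiv [Finite V] : Finite (V ≃ₗ[k] V) := DFunLike.finite _

variable {L : Submodule k V} {g g' : V ≃ₗ[k] V}

theorem inf_chain_eq_bot {m j : ℕ} (h : Disjoint L ((chain L g m).map (g : V →ₗ[k] V)))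
    (hj : j ≤ m) : L ⊓ (chain L g j).map (g : V →ₗ[k] V) = ⊥ :=
  (h.mono_right (Submodule.map_mono (chain_mono L g hj))).eq_bot

theorem finrank_chain [FiniteDimensional k V] {m : ℕ}
    (h : Disjoint L ((chain L g m).map (g : V →ₗ[k] V))) (j : ℕ) (hj : j ≤ m + 1) :
    Module.finrank k (chain L g j) = j * Module.finrank k L := by
  induction j with
  | zero => rw [chain_zero, finrank_bot, zero_mul]
  | succ j ih =>
    have h1 := Submodule.finrank_sup_add_finrank_inf_eq L ((chain L g j).map (g : V →ₗ[k] V))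
    rw [inf_chain_eq_bot h (by omega), finrank_bot, LinearEquiv.finrank_map_eq g,
      ih (by omega)] at h1
    rw [chain_succ, Nat.succ_mul]
    omega

theorem finrank_eq_of_isCompl [FiniteDimensional k V] {m : ℕ}
    (h : IsCompl L ((chain L g m).map (g : V →ₗ[k] V))) :
    (m + 1) * Module.finrank k L = Module.finrank k V := by
  rw [← finrank_chain h.disjoint (m + 1) le_rfl, chain_succ, h.sup_eq_top, finrank_top]

theorem chain_trichotomy [FiniteDimensional k V] (hL : L ≠ ⊥) (g : V ≃ₗ[k] V) :
    (∃ j, 1 ≤ j ∧ chain L g j ≠ ⊤ ∧ (chain L g j).map (g : V →ₗ[k] V) ≤ chain L g j) ∨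
    (∃ j, 1 ≤ j ∧ L ⊓ (chain L g j).map (g : V →ₗ[k] V) ≠ ⊥ ∧
      ¬ L ≤ (chain L g j).map (g : V →ₗ[k] V)) ∨
    ∃ m, IsCompl L ((chain L g m).map (g : V →ₗ[k] V)) := by
  classical
  by_cases hb : ∃ j, 1 ≤ j ∧ L ⊓ (chain L g j).map (g : V →ₗ[k] V) ≠ ⊥ ∧
      ¬ L ≤ (chain L g j).map (g : V →ₗ[k] V)
  · exact Or.inr (Or.inl hb)
  push Not at hb
  obtain ⟨N, hN⟩ := WellFoundedGT.monotone_chain_condition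
    (⟨chain L g, chain_mono L g⟩ : ℕ →o Submodule k V)
  have hN' : ∀ m, N ≤ m → chain L g N = chain L g m := hN
  by_cases ht : chain L g (N + 1) = ⊤
  swap
  · refine Or.inl ⟨N + 1, by omega, ht, ?_⟩
    rw [← hN' (N + 1) (by omega), hN' (N + 1) (by omega), ← hN' (N + 1) (by omega)]
    exact (map_chain_le L g N).trans (hN' (N + 1) (by omega)).ge
  refine Or.inr (Or.inr ?_)
  have hex : ∃ r, L ≤ (chain L g r).map (g : V →ₗ[k] V) := by
    refine ⟨N + 1, ?_⟩
    rw [ht, Submodule.map_top, LinearEquiv.range]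
    exact le_top
  obtain ⟨r, hr, hmin⟩ : ∃ r, L ≤ (chain L g r).map (g : V →ₗ[k] V) ∧
      ∀ j < r, ¬ L ≤ (chain L g j).map (g : V →ₗ[k] V) :=
    ⟨Nat.find hex, Nat.find_spec hex, fun j hj => Nat.find_min hex hj⟩
  obtain _ | m := r
  · rw [chain_zero, Submodule.map_bot, le_bot_iff] at hr
    exact absurd hr hL
  have e1 : chain L g (m + 1) = chain L g (m + 2) := by
    refine Submodule.eq_of_le_of_finrank_eq (chain_le_succ L g _) ?_
    rw [chain_succ L g (m + 1), sup_eq_right.2 hr, LinearEquiv.finrank_map_eq g]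
  have e2 : ∀ i, chain L g (m + 1 + i) = chain L g (m + 1) := fun i => by
    induction i with
    | zero => rfl
    | succ i ih => rw [← add_assoc, chain_succ, ih, ← chain_succ, ← e1]
  have e3 : chain L g (m + 1) = ⊤ := by
    rw [← e2 N, ← hN' _ (by omega), hN' (N + 1) (by omega), ht]
  refine ⟨m, ?_, ?_⟩
  · rcases Nat.eq_zero_or_pos m with rfl | hm
    · rw [chain_zero, Submodule.map_bot]; exact disjoint_bot_right
    · rw [disjoint_iff]
      by_contra h
      exact hmin m (by omega) (hb m hm h)
  · rw [codisjoint_iff, ← chain_succ, e3]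

/-- The map `(l₀, …, l_{j-1}) ↦ ∑ gⁱ lᵢ`. -/
def sumPow (L : Submodule k V) (g : V ≃ₗ[k] V) (j : ℕ) : (Fin j → L) →ₗ[k] V :=
  ∑ i : Fin j, ((g ^ (i : ℕ) : V ≃ₗ[k] V) : V →ₗ[k] V) ∘ₗ L.subtype ∘ₗ LinearMap.proj i

theorem sumPow_apply (j : ℕ) (x : Fin j → L) :
    sumPow L g j x = ∑ i : Fin j, (g ^ (i : ℕ)) (x i : V) := by
  simp [sumPow, LinearMap.sum_apply]

theorem sumPow_cons (j : ℕ) (l : L) (x : Fin j → L) :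
    sumPow L g (j + 1) (Fin.cons l x : Fin (j + 1) → L) = l + g (sumPow L g j x) := by
  rw [sumPow_apply, sumPow_apply, Fin.sum_univ_succ, map_sum]
  simp [pow_succ']

theorem sumPow_snoc (j : ℕ) (l : L) (x : Fin j → L) :
    sumPow L g (j + 1) (Fin.snoc x l : Fin (j + 1) → L) = sumPow L g j x + (g ^ j) (l : V) := by
  rw [sumPow_apply, sumPow_apply, Fin.sum_univ_castSucc]
  simp

theorem mem_chain_iff {j : ℕ} {v : V} : v ∈ chain L g j ↔ ∃ x, sumPow L g j x = v := by
  induction j generalizing v with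
  | zero => simp [chain_zero, sumPow_apply, eq_comm]
  | succ j ih =>
    rw [chain_succ, Submodule.mem_sup]
    constructor
    · rintro ⟨l, hl, _, ⟨w, hw, rfl⟩, rfl⟩
      obtain ⟨x, rfl⟩ := ih.1 hw
      exact ⟨Fin.cons ⟨l, hl⟩ x, sumPow_cons j ⟨l, hl⟩ x⟩
    · rintro ⟨x, rfl⟩
      refine ⟨x 0, (x 0).2, _, Submodule.mem_map_of_mem (ih.2 ⟨Fin.tail x, rfl⟩), ?_⟩
      conv_rhs => rw [← Fin.cons_self_tail x]
      rw [sumPow_cons]; rfl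

theorem sumPow_bijective [FiniteDimensional k V] {m : ℕ}
    (h : IsCompl L ((chain L g m).map (g : V →ₗ[k] V))) :
    Function.Bijective (sumPow L g (m + 1)) := by
  have hs : Function.Surjective (sumPow L g (m + 1)) := fun v => by
    rw [← mem_chain_iff, chain_succ, h.sup_eq_top]; trivial
  refine ⟨(LinearMap.injective_iff_surjective_of_finrank_eq_finrank ?_).2 hs, hs⟩
  rw [← finrank_eq_of_isCompl h, Module.finrank_pi_fintype]
  simp

/-- `c` describes the action of `g ^ (m + 1)` on `L` modulo `g L + ⋯ + g ^ m L`. -/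
def IsReturnMap (L : Submodule k V) (m : ℕ) (g : V ≃ₗ[k] V) (c : L ≃ₗ[k] L) : Prop :=
  IsCompl L ((chain L g m).map (g : V →ₗ[k] V)) ∧
    ∀ l : L, (g ^ (m + 1)) (l : V) - c l ∈ (chain L g m).map (g : V →ₗ[k] V)

theorem exists_isReturnMap [FiniteDimensional k V] {m : ℕ}
    (h : IsCompl L ((chain L g m).map (g : V →ₗ[k] V))) : ∃ c, IsReturnMap L m g c := by
  let c : L →ₗ[k] L := L.projectionOnto _ h ∘ₗ ((g ^ (m + 1) : V ≃ₗ[k] V) : V →ₗ[k] V) ∘ₗ L.subtype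
  have hc : ∀ l : L, c l = L.projectionOnto _ h ((g ^ (m + 1)) (l : V)) := fun l => rfl
  have hinj : Function.Injective c := by
    rw [← LinearMap.ker_eq_bot, LinearMap.ker_eq_bot']
    intro l hl
    rw [hc, Submodule.projectionOnto_apply_eq_zero_iff] at hl
    obtain ⟨w, hw, hwl⟩ := hl
    rw [pow_succ', LinearEquiv.mul_apply] at hwl
    have h1 : w = (g ^ m) (l : V) := g.injective hwl
    obtain ⟨x, rfl⟩ := mem_chain_iff.1 hw
    have h2 : sumPow L g (m + 1) (Fin.snoc x 0 : Fin (m + 1) → L) =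
        sumPow L g (m + 1) (Fin.snoc (0 : Fin m → L) l : Fin (m + 1) → L) := by
      rw [sumPow_snoc, sumPow_snoc, h1]; simp
    have h3 := congrFun ((sumPow_bijective h).1 h2) (Fin.last m)
    simpa using h3.symm
  refine ⟨LinearEquiv.ofInjectiveEndo c hinj, h, fun l => ?_⟩
  rw [← Submodule.projectionOnto_apply_eq_zero_iff h, map_sub]
  have : LinearEquiv.ofInjectiveEndo c hinj l = c l := rfl
  rw [this, Submodule.projectionOnto_apply_left, hc, sub_self]

theorem map_chain_of_intertwine (h : V ≃ₗ[k] V) (κ : L ≃ₗ[k] L) (m : ℕ)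
    (h1 : ∀ l : L, h l = κ l) (h2 : ∀ x ∈ chain L g m, h (g x) = g' (h x)) (j : ℕ)
    (hj : j ≤ m + 1) : (chain L g j).map (h : V →ₗ[k] V) = chain L g' j := by
  have hL : L.map (h : V →ₗ[k] V) = L := by
    ext v
    constructor
    · rintro ⟨l, hl, rfl⟩
      have := h1 ⟨l, hl⟩
      exact this ▸ (κ ⟨l, hl⟩).2
    · intro hv
      exact ⟨κ.symm ⟨v, hv⟩, (κ.symm _).2, by
        have := h1 (κ.symm ⟨v, hv⟩)
        simpa using this⟩
  induction j with
  | zero => simp [chain_zero]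
  | succ j ih =>
    rw [chain_succ, chain_succ, Submodule.map_sup, hL, ← ih (by omega)]
    congr 1
    ext v
    constructor
    · rintro ⟨_, ⟨x, hx, rfl⟩, rfl⟩
      exact ⟨h x, Submodule.mem_map_of_mem hx, (h2 x (chain_mono L g (by omega) hx)).symm⟩
    · rintro ⟨_, ⟨x, hx, rfl⟩, rfl⟩
      exact ⟨g x, Submodule.mem_map_of_mem hx, h2 x (chain_mono L g (by omega) hx)⟩

theorem exists_intertwine [FiniteDimensional k V] {m : ℕ}
    (hg : IsCompl L ((chain L g m).map (g : V →ₗ[k] V)))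
    (hg' : IsCompl L ((chain L g' m).map (g' : V →ₗ[k] V))) (κ : L ≃ₗ[k] L) :
    ∃ h : V ≃ₗ[k] V, (∀ l : L, h l = κ l) ∧ ∀ x ∈ chain L g m, h (g x) = g' (h x) := by
  let Ψ := LinearEquiv.ofBijective _ (sumPow_bijective hg)
  let Ψ' := LinearEquiv.ofBijective _ (sumPow_bijective hg')
  let K : (Fin (m + 1) → L) ≃ₗ[k] (Fin (m + 1) → L) := LinearEquiv.piCongrRight fun _ => κ
  let h : V ≃ₗ[k] V := Ψ.symm ≪≫ₗ K ≪≫ₗ Ψ'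
  have hh : ∀ y, h (sumPow L g (m + 1) y) = sumPow L g' (m + 1) (fun i => κ (y i)) := fun y => by
    have : Ψ.symm (sumPow L g (m + 1) y) = y := Ψ.symm_apply_apply y
    simp only [h, LinearEquiv.trans_apply, this]
    rfl
  have e1 : ∀ (l : L) (y : Fin m → L), (fun i => κ ((Fin.cons l y : Fin (m + 1) → L) i)) =
      (Fin.cons (κ l) (fun i => κ (y i)) : Fin (m + 1) → L) := fun l y => by
    ext i; refine Fin.cases ?_ (fun i => ?_) i <;> simp
  have e2 : ∀ (l : L) (y : Fin m → L), (fun i => κ ((Fin.snoc y l : Fin (m + 1) → L) i)) =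
      (Fin.snoc (fun i => κ (y i)) (κ l) : Fin (m + 1) → L) := fun l y => by
    ext i; refine Fin.lastCases ?_ (fun i => ?_) i <;> simp
  refine ⟨h, fun l => ?_, fun x hx => ?_⟩
  · have := hh (Fin.cons l 0)
    rw [e1, sumPow_cons, sumPow_cons] at this
    simpa [← Pi.zero_def] using this
  · obtain ⟨y, rfl⟩ := mem_chain_iff.1 hx
    have h1 := hh (Fin.cons 0 y)
    have h2 := hh (Fin.snoc y 0)
    rw [e1, sumPow_cons, sumPow_cons] at h1
    rw [e2, sumPow_snoc, sumPow_snoc] at h2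
    simp only [Submodule.coe_zero, map_zero, zero_add, add_zero] at h1 h2
    rw [h1, h2]

/-- If the return maps are conjugate, so are the elements up to the group of the filtration. -/
theorem exists_conj_of_isReturnMap [Finite V] {m : ℕ} {c c' κ : L ≃ₗ[k] L}
    (hg : IsReturnMap L m g c) (hg' : IsReturnMap L m g' c') (hκ : ∀ l, c' (κ l) = κ (c l)) :
    ∃ h : V ≃ₗ[k] V, (∃ u ∈ chainGroup L g' (m + 1), h * g * h⁻¹ = g' * u) ∧
      ∀ x, h * x * h⁻¹ ∈ chainGroup L g' (m + 1) ↔ x ∈ chainGroup L g (m + 1) := by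
  obtain ⟨h, h1, h2⟩ := exists_intertwine hg.1 hg'.1 κ
  have hF := map_chain_of_intertwine h κ m h1 h2
  have hFm : ∀ j ≤ m + 1, ∀ v, h v ∈ chain L g' j ↔ v ∈ chain L g j := fun j hj v => by
    rw [← hF j hj]
    exact ⟨fun ⟨w, hw, e⟩ => h.injective e ▸ hw, fun hv => Submodule.mem_map_of_mem hv⟩
  refine ⟨h, ⟨g'⁻¹ * (h * g * h⁻¹), ?_, by group⟩, fun x => ?_⟩
  · have htop : ∀ v : V, v ∈ chain L g (m + 1) := fun v => by
      rw [chain_succ, hg.1.sup_eq_top]; trivial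
    have htop' : ∀ v : V, v ∈ chain L g' (m + 1) := fun v => by
      rw [chain_succ, hg'.1.sup_eq_top]; trivial
    have e : ∀ x, (g'⁻¹ * (h * g * h⁻¹)) (h x) - h x = g'.symm (h (g x) - g' (h x)) := fun x => by
      rw [map_sub, LinearEquiv.symm_apply_apply]
      change g'.symm (h (g (h.symm (h x)))) - h x = _
      rw [LinearEquiv.symm_apply_apply]
    have hu0 : ∀ x ∈ chain L g m, (g'⁻¹ * (h * g * h⁻¹)) (h x) - h x = 0 := fun x hx => by
      rw [e, h2 x hx, sub_self, map_zero]
    refine mem_chainGroup.2 ⟨fun v => htop' _, fun i hi v hv => ?_⟩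
    obtain ⟨x, rfl⟩ := h.surjective v
    rw [hFm _ (by omega)] at hv
    rcases Nat.lt_succ_iff_lt_or_eq.1 hi with hi' | rfl
    · rw [hu0 x (chain_mono L g (by omega) hv)]; exact zero_mem _
    · obtain ⟨y, rfl⟩ := mem_chain_iff.1 hv
      rw [← Fin.snoc_init_self y, sumPow_snoc, map_add, map_add, add_sub_add_comm,
        hu0 _ (mem_chain_iff.2 ⟨_, rfl⟩), zero_add, e]
      set l := y (Fin.last i)
      have hm : ∀ {X : Submodule k V} {v}, v ∈ X.map (g' : V →ₗ[k] V) → g'.symm v ∈ X := by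
        rintro X _ ⟨v, hv, rfl⟩; simpa using hv
      apply hm
      obtain ⟨x, hx, hxl⟩ := hg.2 l
      have a1 : h (g ((g ^ i) (l : V))) = κ (c l) + g' (h x) := by
        have : g ((g ^ i) (l : V)) = c l + g x := by
          rw [← LinearEquiv.mul_apply, ← pow_succ']
          exact (sub_eq_iff_eq_add'.1 hxl.symm)
        rw [this, map_add, h1, h2 x hx]
      have a2 : ∀ j ≤ i, h ((g ^ j) (l : V)) = (g' ^ j) (κ l : V) := fun j => by
        induction j with
        | zero => intro _; simpa using h1 l
        | succ j ih =>
          intro hj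
          have hmem : (g ^ j) (l : V) ∈ chain L g i := by
            refine chain_mono L g hj ?_
            refine mem_chain_iff.2 ⟨Fin.snoc (0 : Fin j → L) l, ?_⟩
            rw [sumPow_snoc]; simp
          rw [pow_succ', pow_succ', LinearEquiv.mul_apply, LinearEquiv.mul_apply, h2 _ hmem,
            ih (by omega)]
      have a3 := hg'.2 (κ l)
      rw [hκ, pow_succ', LinearEquiv.mul_apply, ← a2 i le_rfl] at a3
      have a4 : g' (h x) ∈ (chain L g' i).map (g' : V →ₗ[k] V) :=
        Submodule.mem_map_of_mem ((hFm i (by omega) x).2 hx)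
      rw [a1]
      have := sub_mem a4 a3
      convert this using 1
      abel
  · have e : ∀ v, (h * x * h⁻¹) (h v) - h v = h (x v - v) := fun v => by
      rw [map_sub]
      change h (x (h.symm (h v))) - h v = _
      rw [LinearEquiv.symm_apply_apply]
    rw [mem_chainGroup, mem_chainGroup]
    refine and_congr ⟨fun H v => ?_, fun H v => ?_⟩ ⟨fun H i hi v hv => ?_, fun H i hi v hv => ?_⟩
    · rw [← hFm _ le_rfl, ← e]; exact H _
    · obtain ⟨v, rfl⟩ := h.surjective v
      rw [e, hFm _ le_rfl]; exact H _
    · rw [← hFm _ (by omega), ← e]; exact H i hi _ ((hFm _ (by omega) _).2 hv)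
    · obtain ⟨v, rfl⟩ := h.surjective v
      rw [e, hFm _ (by omega)]; exact H i hi _ ((hFm _ (by omega) _).1 hv)

end Parahoric

namespace Parahoric

open GroupAverage MonoidAlgebra

variable {k V : Type} [Field k] [AddCommGroup V] [Module k V]

/-- A linear retraction onto a subspace. -/
noncomputable def retraction (L : Submodule k V) : V →ₗ[k] L :=
  (LinearMap.exists_leftInverse_of_injective L.subtype (Submodule.ker_subtype _)).choose

theorem retraction_apply (L : Submodule k V) (l : L) : retraction L l = l :=
  LinearMap.congr_fun
    (LinearMap.exists_leftInverse_of_injective L.subtype (Submodule.ker_subtype _)).choose_spec l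

/-- The extension of an automorphism of `L` acting trivially on the kernel of `retraction L`. -/
noncomputable def levi (L : Submodule k V) : (L ≃ₗ[k] L) →* (V ≃ₗ[k] V) :=
  let f (h : L ≃ₗ[k] L) : V →ₗ[k] V :=
    LinearMap.id + L.subtype ∘ₗ ((h : L →ₗ[k] L) - LinearMap.id) ∘ₗ retraction L
  have hf (a b : L ≃ₗ[k] L) : f a ∘ₗ f b = f (a * b) := LinearMap.ext fun v => by
    simp [f, retraction_apply]
    abel
  have hf1 : f 1 = LinearMap.id := LinearMap.ext fun v => by
    simp [f]
  { toFun := fun h => LinearEquiv.ofLinearMap (f h) (f h⁻¹)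
      (by rw [hf, mul_inv_cancel, hf1]) (by rw [hf, inv_mul_cancel, hf1])
    map_one' := LinearEquiv.ext fun v => LinearMap.congr_fun hf1 v
    map_mul' := fun a b => LinearEquiv.ext fun v => (LinearMap.congr_fun (hf a b) v).symm }

variable {L : Submodule k V}

theorem levi_apply (h : L ≃ₗ[k] L) (v : V) :
    levi L h v = v + ((h (retraction L v) : V) - (retraction L v : V)) := rfl

theorem levi_coe (h : L ≃ₗ[k] L) (l : L) : levi L h (l : V) = h l := by
  rw [levi_apply, retraction_apply]; abel

theorem levi_sub_mem (h : L ≃ₗ[k] L) (v : V) : levi L h v - v ∈ L := by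
  rw [levi_apply, add_sub_cancel_left]
  exact sub_mem (h _).2 (retraction L v).2

theorem map_levi_of_le (h : L ≃ₗ[k] L) {X : Submodule k V} (hX : L ≤ X) :
    X.map (levi L h : V →ₗ[k] V) = X := by
  have key : ∀ (h : L ≃ₗ[k] L), ∀ v ∈ X, levi L h v ∈ X := fun h v hv => by
    simpa using add_mem (hX (levi_sub_mem h v)) hv
  ext v
  constructor
  · rintro ⟨w, hw, rfl⟩
    exact key h w hw
  · intro hv
    refine ⟨levi L h⁻¹ v, key _ v hv, ?_⟩
    change (levi L h * levi L h⁻¹) v = v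
    rw [← map_mul, mul_inv_cancel, map_one]; rfl

theorem map_mul_levi_chain (g g' : V ≃ₗ[k] V) (h : L ≃ₗ[k] L) (i : ℕ) :
    (chain L g i).map (g' * levi L h : V ≃ₗ[k] V).toLinearMap =
      (chain L g i).map (g' : V →ₗ[k] V) := by
  rcases Nat.eq_zero_or_pos i with rfl | hi
  · rw [chain_zero, Submodule.map_bot, Submodule.map_bot]
  · have : (g' * levi L h : V ≃ₗ[k] V).toLinearMap =
      (g' : V →ₗ[k] V) ∘ₗ (levi L h : V →ₗ[k] V) := rfl
    rw [this, Submodule.map_comp, map_levi_of_le h (le_chain L g hi)]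

theorem chain_mul_levi (g : V ≃ₗ[k] V) (h : L ≃ₗ[k] L) (i : ℕ) :
    chain L (g * levi L h) i = chain L g i := by
  induction i with
  | zero => rfl
  | succ i ih =>
    rw [chain_succ, chain_succ, ih]
    exact congrArg _ (map_mul_levi_chain g g h i)

theorem map_chain_mul_levi (g : V ≃ₗ[k] V) (h : L ≃ₗ[k] L) (i : ℕ) :
    (chain L (g * levi L h) i).map (g * levi L h : V ≃ₗ[k] V).toLinearMap =
      (chain L g i).map (g : V →ₗ[k] V) := by
  rw [chain_mul_levi, map_mul_levi_chain]

theorem IsReturnMap.mul_levi {m : ℕ} {g : V ≃ₗ[k] V} {c : L ≃ₗ[k] L} (hg : IsReturnMap L m g c)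
    (h : L ≃ₗ[k] L) : IsReturnMap L m (g * levi L h) (c * h) := by
  have key : ∀ (i : ℕ) (l : L), ((g * levi L h) ^ (i + 1)) (l : V) - (g ^ (i + 1)) (h l : V) ∈
      (chain L g i).map (g : V →ₗ[k] V) := by
    intro i l
    induction i with
    | zero => simp [levi_coe]
    | succ i ih =>
      obtain ⟨x, hx, hxl⟩ := ih
      rw [pow_succ', LinearEquiv.mul_apply, pow_succ' g, LinearEquiv.mul_apply]
      have e : ((g * levi L h) ^ (i + 1)) (l : V) = (g ^ (i + 1)) (h l : V) + g x :=
        sub_eq_iff_eq_add'.1 hxl.symm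
      set y := ((g * levi L h) ^ (i + 1)) (l : V)
      rw [LinearEquiv.mul_apply, ← map_sub]
      refine Submodule.mem_map_of_mem ?_
      have h1 : levi L h y - y ∈ chain L g (i + 1) := le_chain L g (by omega) (levi_sub_mem h y)
      have h2 : g x ∈ chain L g (i + 1) := apply_mem_chain L g hx
      have := add_mem h1 h2
      convert this using 1
      rw [e]; abel
  refine ⟨by simpa only [map_chain_mul_levi] using hg.1, fun l => ?_⟩
  simp only [map_chain_mul_levi]
  have := add_mem (key m l) (hg.2 (h l))
  simpa using this

variable [Finite V]

variable {R : Type} [Field R]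

/-- A trace form on the group algebra that vanishes on elements with a proper invariant subspace
and on the averages attached to subspaces of `L`. -/
structure IsVanishingForm (L : Submodule k V) (F : MonoidAlgebra R (V ≃ₗ[k] V) →ₗ[R] R) :
    Prop where
  mul_comm : ∀ a b, F (a * b) = F (b * a)
  reducible : ∀ (g : V ≃ₗ[k] V) (X : Submodule k V), X ≠ ⊥ → X ≠ ⊤ →
    (∀ v ∈ X, g v ∈ X) → F (of R _ g) = 0
  small : ∀ X : Submodule k V, X ≠ ⊥ → X < L → ∀ y, F (y * avg R (unip X)) = 0

theorem of_mul_avg_chainGroup (g : V ≃ₗ[k] V) (j : ℕ) :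
    of R _ g * avg R (chainGroup L g j) =
      avg R ((chainGroup L g j).map (MulAut.conj g).toMonoidHom) * of R _ g :=
  of_mul_avg_mul_of _ _ g fun x => ⟨fun ⟨y, hy, e⟩ => by
    have : y = x := by simpa using e
    exact this ▸ hy, fun hx => ⟨x, hx, rfl⟩⟩

variable [CharZero R] {F : MonoidAlgebra R (V ≃ₗ[k] V) →ₗ[R] R} {g g' : V ≃ₗ[k] V}

namespace IsVanishingForm

theorem map_of_mul_avg_eq (hF : IsVanishingForm L F) (j : ℕ) :
    F (of R _ g * avg R (chainGroup L g j)) =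
      F (avg R (chainGroup L g j) *
        avg R ((chainGroup L g j).map (MulAut.conj g).toMonoidHom) * of R _ g) := by
  rw [mul_assoc, ← of_mul_avg_chainGroup, hF.mul_comm, hF.mul_comm _ (_ * _), mul_assoc,
    avg_mul_self, hF.mul_comm]

theorem map_avg_chainGroup_succ (hF : IsVanishingForm L F) {j : ℕ} (hj : 1 ≤ j) :
    F (of R _ g * avg R (chainGroup L g j)) = F (of R _ g * avg R (chainGroup L g (j + 1))) := by
  rw [hF.map_of_mul_avg_eq,
    ← avg_mul_avg_mul_avg (C := chainGroup L g (j + 1))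
      (fun c hc => exists_mul_of_mem_chainGroup_succ hj hc),
    mul_assoc, ← of_mul_avg_chainGroup, avg_mul_avg_of_le (chainGroup_le_succ j), ← mul_assoc,
    hF.mul_comm, ← mul_assoc, avg_mul_avg_of_le (chainGroup_le_succ j), hF.mul_comm]

theorem map_avg_unip (hF : IsVanishingForm L F) {j : ℕ} (hj : 1 ≤ j) :
    F (of R _ g * avg R (unip L)) = F (of R _ g * avg R (chainGroup L g j)) := by
  induction j, hj using Nat.le_induction with
  | base => rw [chainGroup_one]
  | succ j hj ih => rw [ih, hF.map_avg_chainGroup_succ hj]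

theorem map_avg_unip_eq_zero (hF : IsVanishingForm L F) (hL : L ≠ ⊥)
    (h : ∀ m, ¬ IsCompl L ((chain L g m).map (g : V →ₗ[k] V))) :
    F (of R _ g * avg R (unip L)) = 0 := by
  rcases chain_trichotomy hL g with ⟨j, hj, ht, hs⟩ | ⟨j, hj, h1, h2⟩ | ⟨m, hm⟩
  · rw [hF.map_avg_unip hj, ← mul_one (_ * _)]
    refine map_mul_avg_mul_eq F _ _ _ _ fun u hu => ?_
    rw [mul_one, ← map_mul]
    refine hF.reducible _ (chain L g j) (fun h0 => hL ?_) ht fun v hv => ?_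
    · exact le_bot_iff.1 (h0 ▸ le_chain L g hj)
    · refine hs (Submodule.mem_map_of_mem ?_)
      simpa using add_mem ((mem_chainGroup.1 hu).1 v) hv
  · rw [hF.map_avg_unip hj, hF.map_of_mul_avg_eq,
      ← avg_mul_avg_mul_avg (fun c hc => exists_mul_of_mem_unip hj hc), mul_assoc, hF.mul_comm,
      ← mul_assoc]
    exact hF.small _ h1 (lt_of_le_of_ne inf_le_left fun e => h2 (inf_eq_left.1 e)) _
  · exact absurd hm (h m)

theorem map_avg_unip_eq (hF : IsVanishingForm L F) {m : ℕ} {c c' κ : L ≃ₗ[k] L}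
    (hg : IsReturnMap L m g c) (hg' : IsReturnMap L m g' c') (hκ : ∀ l, c' (κ l) = κ (c l)) :
    F (of R _ g * avg R (unip L)) = F (of R _ g' * avg R (unip L)) := by
  obtain ⟨h, ⟨u, hu, hgu⟩, hh⟩ := exists_conj_of_isReturnMap hg hg' hκ
  rw [hF.map_avg_unip (j := m + 1) (by omega), hF.map_avg_unip (j := m + 1) (by omega)]
  have e1 : of R _ g = of R _ h⁻¹ * of R _ (g' * u) * of R _ h := by
    rw [← map_mul, ← map_mul, ← hgu]; congr 1; group
  rw [e1, mul_assoc, of_mul_avg_mul_of _ _ h hh, hF.mul_comm, mul_assoc]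
  have e2 : of R _ h * of R _ h⁻¹ = 1 := by rw [← map_mul, mul_inv_cancel, map_one]
  have e3 : of R _ (g' * u) = of R _ g' * of R _ u := (MonoidAlgebra.of R _).map_mul _ _
  rw [← mul_assoc (of R _ h), e2, one_mul, e3, hF.mul_comm, mul_assoc,
    GroupAverage.of_mul_avg _ hu]

end IsVanishingForm

end Parahoric

namespace Parahoric

open GroupAverage

variable {k V : Type} [Field k] [AddCommGroup V] [Module k V] {L : Submodule k V}
variable {R : Type} [Field R]

theorem linearMap_ext_of {G : Type} [Monoid G] {M : Type} [AddCommGroup M] [Module R M]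
    {f f' : MonoidAlgebra R G →ₗ[R] M}
    (h : ∀ g, f (MonoidAlgebra.of R G g) = f' (MonoidAlgebra.of R G g)) (y) :
    f y = f' y := by
  induction y using MonoidAlgebra.induction_on with
  | of g => exact h g
  | add x y hx hy => rw [map_add, map_add, hx, hy]
  | smul r x hx => rw [map_smul, map_smul, hx]

/-- The embedding of group algebras attached to `levi`. -/
noncomputable def leviAlg (R : Type) [Field R] (L : Submodule k V) :
    MonoidAlgebra R (L ≃ₗ[k] L) →ₐ[R] MonoidAlgebra R (V ≃ₗ[k] V) :=
  MonoidAlgebra.lift R _ _ ((MonoidAlgebra.of R _).comp (levi L))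

theorem leviAlg_of (h : L ≃ₗ[k] L) :
    leviAlg R L (MonoidAlgebra.of R _ h) = MonoidAlgebra.of R _ (levi L h) := by
  simp [leviAlg]

/-- The linear map `y ↦ F (x * (y * z))` on the group algebra of `L`. -/
noncomputable def sliceForm (L : Submodule k V) (F : MonoidAlgebra R (V ≃ₗ[k] V) →ₗ[R] R)
    (x z : MonoidAlgebra R (V ≃ₗ[k] V)) : MonoidAlgebra R (L ≃ₗ[k] L) →ₗ[R] R :=
  F ∘ₗ LinearMap.mulLeft R x ∘ₗ LinearMap.mulRight R z ∘ₗ (leviAlg R L).toLinearMap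

theorem sliceForm_apply (F : MonoidAlgebra R (V ≃ₗ[k] V) →ₗ[R] R)
    (x z : MonoidAlgebra R (V ≃ₗ[k] V)) (y) :
    sliceForm L F x z y = F (x * (leviAlg R L y * z)) := rfl

theorem sliceForm_of (F : MonoidAlgebra R (V ≃ₗ[k] V) →ₗ[R] R)
    (g : V ≃ₗ[k] V) (z : MonoidAlgebra R (V ≃ₗ[k] V)) (h) :
    sliceForm L F (MonoidAlgebra.of R _ g) z (MonoidAlgebra.of R _ h) =
      F (MonoidAlgebra.of R _ (g * levi L h) * z) := by
  rw [sliceForm_apply, leviAlg_of, ← mul_assoc, ← map_mul]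

variable [Finite V] [CharZero R] {F : MonoidAlgebra R (V ≃ₗ[k] V) →ₗ[R] R} {g g' : V ≃ₗ[k] V}

namespace IsVanishingForm

theorem sliceForm_eq_zero (hF : IsVanishingForm L F) (hL : L ≠ ⊥)
    (h : ∀ m, ¬ IsCompl L ((chain L g m).map (g : V →ₗ[k] V))) (y) :
    sliceForm L F (MonoidAlgebra.of R _ g) (avg R (unip L)) y = 0 :=
  linearMap_ext_of (f' := 0) (fun x => by
    rw [sliceForm_of, hF.map_avg_unip_eq_zero hL fun m => by rw [map_chain_mul_levi]; exact h m]
    rfl) y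

theorem sliceForm_eq (hF : IsVanishingForm L F) {m : ℕ} {c c' : L ≃ₗ[k] L}
    (hg : IsReturnMap L m g c) (hg' : IsReturnMap L m g' c') (y) :
    sliceForm L F (MonoidAlgebra.of R _ g) (avg R (unip L)) y =
      sliceForm L F (MonoidAlgebra.of R _ g') (avg R (unip L)) (MonoidAlgebra.of R _ (c'⁻¹ * c) * y) :=
  linearMap_ext_of
    (f' := sliceForm L F (MonoidAlgebra.of R _ g') (avg R (unip L)) ∘ₗ
      LinearMap.mulLeft R (MonoidAlgebra.of R _ (c'⁻¹ * c)))
    (fun x => by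
      rw [LinearMap.comp_apply, LinearMap.mulLeft_apply, ← map_mul, sliceForm_of, sliceForm_of]
      refine hF.map_avg_unip_eq (κ := 1) (hg.mul_levi x) (hg'.mul_levi _) fun l => ?_
      simp) y

theorem sliceForm_mul_comm (hF : IsVanishingForm L F) {m : ℕ} {c : L ≃ₗ[k] L}
    (hg : IsReturnMap L m g c) (a b) :
    sliceForm L F (MonoidAlgebra.of R _ g) (avg R (unip L)) (MonoidAlgebra.of R _ c⁻¹ * (a * b)) =
      sliceForm L F (MonoidAlgebra.of R _ g) (avg R (unip L)) (MonoidAlgebra.of R _ c⁻¹ * (b * a)) := by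
  set Φ := sliceForm L F (MonoidAlgebra.of R _ g) (avg R (unip L)) ∘ₗ
    LinearMap.mulLeft R (MonoidAlgebra.of R _ c⁻¹) with hΦ
  suffices h : ∀ x y, Φ (MonoidAlgebra.of R _ x * MonoidAlgebra.of R _ y) =
      Φ (MonoidAlgebra.of R _ y * MonoidAlgebra.of R _ x) by
    change Φ (a * b) = Φ (b * a)
    refine linearMap_ext_of (f := Φ ∘ₗ LinearMap.mulRight R b) (f' := Φ ∘ₗ LinearMap.mulLeft R b)
      (fun x => ?_) a
    exact linearMap_ext_of (f := Φ ∘ₗ LinearMap.mulLeft R (MonoidAlgebra.of R _ x))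
      (f' := Φ ∘ₗ LinearMap.mulRight R (MonoidAlgebra.of R _ x)) (fun y => h x y) b
  intro x y
  rw [hΦ, LinearMap.comp_apply, LinearMap.comp_apply, LinearMap.mulLeft_apply,
    LinearMap.mulLeft_apply, ← map_mul, ← map_mul, ← map_mul, ← map_mul, sliceForm_of,
    sliceForm_of]
  refine hF.map_avg_unip_eq (κ := y) (hg.mul_levi _) (hg.mul_levi _) fun l => ?_
  simp

end IsVanishingForm

variable (R) in
theorem exists_common_form (hL : L ≠ ⊥) (SL : MatrixSplitting R (MonoidAlgebra R (L ≃ₗ[k] L)))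
    (i : Fin SL.num) : ∃ ψ : (V ≃ₗ[k] V) → R, ∀ F : MonoidAlgebra R (V ≃ₗ[k] V) →ₗ[R] R,
      IsVanishingForm L F → ∃ κ, ∀ g,
        F (MonoidAlgebra.of R _ g * (leviAlg R L (SL.lift i 1) * avg R (unip L))) = κ * ψ g := by
  classical
  by_cases h0 : ∃ (g₀ : V ≃ₗ[k] V) (m₀ : ℕ), IsCompl L ((chain L g₀ m₀).map (g₀ : V →ₗ[k] V))
  · obtain ⟨g₀, m₀, h₀⟩ := h0
    obtain ⟨c₀, hc₀⟩ := exists_isReturnMap h₀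
    have hm : ∀ (g : V ≃ₗ[k] V) m, IsCompl L ((chain L g m).map (g : V →ₗ[k] V)) → m = m₀ := by
      intro g m h
      have h1 := (finrank_eq_of_isCompl h).trans (finrank_eq_of_isCompl h₀).symm
      have h2 : Module.finrank k L ≠ 0 := fun h => hL (Submodule.finrank_eq_zero.1 h)
      exact Nat.succ_injective (Nat.eq_of_mul_eq_mul_right (Nat.pos_of_ne_zero h2) h1)
    refine ⟨fun g => if h : ∃ c, IsReturnMap L m₀ g c then SL.chi i (MonoidAlgebra.of R _ h.choose)
      else 0,
      fun F hF => ?_⟩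
    obtain ⟨κ, hκ⟩ := SL.exists_eq_mul_chi i
      (sliceForm L F (MonoidAlgebra.of R _ g₀) (avg R (unip L)) ∘ₗ
        LinearMap.mulLeft R (MonoidAlgebra.of R _ c₀⁻¹))
      (fun a b => by
        rw [LinearMap.comp_apply, LinearMap.comp_apply, LinearMap.mulLeft_apply,
          LinearMap.mulLeft_apply, hF.sliceForm_mul_comm hc₀])
    refine ⟨κ, fun g => ?_⟩
    rw [← sliceForm_apply]
    beta_reduce
    split_ifs with h
    · rw [hF.sliceForm_eq h.choose_spec hc₀, ← hκ, LinearMap.comp_apply, LinearMap.mulLeft_apply,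
        ← mul_assoc, ← map_mul]
    · rw [mul_zero]
      refine hF.sliceForm_eq_zero hL (fun m hm' => h ?_) _
      obtain rfl := hm g m hm'
      exact exists_isReturnMap hm'
  · refine ⟨0, fun F hF => ⟨0, fun g => ?_⟩⟩
    rw [← sliceForm_apply, hF.sliceForm_eq_zero hL fun m h => h0 ⟨g, m, h⟩]
    simp

theorem mul_avg_unip_reducible {F' : MonoidAlgebra R (V ≃ₗ[k] V) →ₗ[R] R} (hL : L ≠ ⊥)
    (hL' : L ≠ ⊤)
    (h : ∀ (g : V ≃ₗ[k] V) (X : Submodule k V), X ≠ ⊥ → X ≠ ⊤ → (∀ v ∈ X, g v ∈ X) →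
      F (MonoidAlgebra.of R _ g) = F' (MonoidAlgebra.of R _ g)) (y) :
    F (leviAlg R L y * avg R (unip L)) = F' (leviAlg R L y * avg R (unip L)) := by
  have e : ∀ F y, F (leviAlg R L y * avg R (unip L)) =
    sliceForm L F (MonoidAlgebra.of R _ 1) (avg R (unip L)) y := fun F y => by
      rw [sliceForm_apply, map_one, one_mul]
  rw [e, e]
  refine linearMap_ext_of (fun x => ?_) y
  rw [sliceForm_of, sliceForm_of, one_mul, ← sub_eq_zero, ← LinearMap.sub_apply,
    ← mul_one (_ * _)]
  refine map_mul_avg_mul_eq _ _ _ _ _ fun u hu => ?_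
  rw [mul_one, ← map_mul, LinearMap.sub_apply, sub_eq_zero]
  refine h _ L hL hL' fun v hv => ?_
  rw [LinearEquiv.mul_apply, (mem_unip.1 hu).2 v hv]
  have := levi_coe x ⟨v, hv⟩
  exact this ▸ (x _).2

/-- Three irreducible representations whose characters agree on the elements with a proper
invariant subspace have no nonzero vectors fixed by the unipotent groups. -/
theorem rep_avg_unip_eq_zero [IsAlgClosed R]
    (S : MatrixSplitting R (MonoidAlgebra R (V ≃ₗ[k] V)))
    (a : Fin 3 → Fin S.num) (ha : Function.Injective a)
    (hred : ∀ (g : V ≃ₗ[k] V) (X : Submodule k V), X ≠ ⊥ → X ≠ ⊤ → (∀ v ∈ X, g v ∈ X) →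
      ∀ x y, S.chi (a x) (MonoidAlgebra.of R _ g) = S.chi (a y) (MonoidAlgebra.of R _ g))
    (L : Submodule k V) (hL : L ≠ ⊥) (hL' : L ≠ ⊤) (x : Fin 3) :
    S.rep (a x) (avg R (unip L)) = 0 := by
  induction hr : Module.finrank k L using Nat.strong_induction_on generalizing L x with
  | _ r ih =>
  subst hr
  have hsmall : ∀ X : Submodule k V, X ≠ ⊥ → X < L → ∀ x, S.rep (a x) (avg R (unip X)) = 0 :=
    fun X h1 h2 x => ih _ (Submodule.finrank_lt_finrank_of_lt h2) X h1
      (fun h => hL' (top_le_iff.1 (h ▸ h2.le))) x rfl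
  have hvan : ∀ x, IsVanishingForm L (S.chi (a 0) - S.chi (a x)) := fun x =>
    ⟨fun b c => by simp only [LinearMap.sub_apply, S.chi_mul_comm],
      fun g X h1 h2 h3 => by rw [LinearMap.sub_apply, hred g X h1 h2 h3 0 x, sub_self],
      fun X h1 h2 y => by
        simp [MatrixSplitting.chi_apply, map_mul, hsmall X h1 h2]⟩
  have heq : ∀ x y z, S.chi (a x) (leviAlg R L z * avg R (unip L)) =
      S.chi (a y) (leviAlg R L z * avg R (unip L)) := fun x y z =>
    mul_avg_unip_reducible hL hL' (fun g X h1 h2 h3 => hred g X h1 h2 h3 x y) z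
  obtain ⟨SL⟩ := MatrixSplitting.nonempty_monoidAlgebra (R := R) (L ≃ₗ[k] L)
  refine (S.chi_natCast (a x) (avg_mul_self _)).2 ?_
  have hsum : avg R (unip L) = ∑ i, leviAlg R L (SL.lift i 1) * avg R (unip L) := by
    rw [← Finset.sum_mul, ← map_sum, SL.sum_lift_one, map_one, one_mul]
  rw [hsum, map_sum]
  refine Finset.sum_eq_zero fun i _ => ?_
  by_contra hne
  set e := leviAlg R L (SL.lift i 1) * avg R (unip L) with he
  obtain ⟨ψ, hψ⟩ := exists_common_form R hL SL i
  obtain ⟨κ₁, h₁⟩ := hψ _ (hvan 1)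
  obtain ⟨κ₂, h₂⟩ := hψ _ (hvan 2)
  have key : ∀ α β : R, α * κ₁ + β * κ₂ = 0 → ∀ y,
      α * (S.chi (a 0) - S.chi (a 1)) (y * e) + β * (S.chi (a 0) - S.chi (a 2)) (y * e) = 0 := by
    intro α β hαβ y
    refine linearMap_ext_of (f := (α • (S.chi (a 0) - S.chi (a 1)) +
      β • (S.chi (a 0) - S.chi (a 2))) ∘ₗ LinearMap.mulRight R e) (f' := 0) (fun g => ?_) y
    have : α * (κ₁ * ψ g) + β * (κ₂ * ψ g) = 0 := by linear_combination ψ g * hαβ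
    rw [← h₁, ← h₂] at this
    exact this
  have hne' : ∀ y, S.chi (a y) e ≠ 0 := fun y h => hne ((heq x y _).trans h)
  have hz : ∀ α β : R, α * κ₁ + β * κ₂ = 0 → α = 0 ∧ β = 0 := by
    intro α β hαβ
    have hl : ∀ i j : Fin S.num, S.chi i (S.lift j 1 * e) = if i = j then S.chi i e else 0 := by
      intro i j
      split_ifs with h
      · subst h; rw [MatrixSplitting.chi_apply, map_mul, S.rep_lift, one_mul]; rfl
      · rw [MatrixSplitting.chi_apply, map_mul, S.rep_lift_of_ne h, zero_mul, Matrix.trace_zero]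
    have k1 := key α β hαβ (S.lift (a 1) 1)
    have k2 := key α β hαβ (S.lift (a 2) 1)
    simp only [LinearMap.sub_apply, hl, ha.eq_iff] at k1 k2
    simp at k1 k2
    exact ⟨k1.resolve_right (hne' 1), k2.resolve_right (hne' 2)⟩
  by_cases hκ : κ₁ = 0
  · exact one_ne_zero (hz 1 0 (by rw [hκ]; ring)).1
  · exact hκ (neg_eq_zero.1 (hz κ₂ (-κ₁) (by ring)).2)

end Parahoric

namespace RegularExponents

theorem card_le_of_dvd_sub {M n : ℕ} (hM : 0 < M) (hn : 0 < n) {S : Finset ℕ}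
    (hS : S ⊆ Finset.range M)
    (h : ∀ i ∈ S, ∀ j ∈ S, (M : ℤ) ∣ ((i : ℤ) - j) * n) : S.card ≤ n := by
  have hM' : (0 : ℤ) < M := by exact_mod_cast hM
  rw [← Finset.card_range n]
  refine Finset.card_le_card_of_injOn (fun j => n * j / M) (fun j hj => ?_) fun i hi j hj hij => ?_
  · have := Finset.mem_range.1 (hS hj)
    simp only [Finset.coe_range, Set.mem_Iio]
    rw [Nat.div_lt_iff_lt_mul hM]
    exact Nat.mul_lt_mul_of_pos_left this hn
  · obtain ⟨c, hc⟩ := h i hi j hj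
    have h1 := Nat.div_add_mod (n * i) M
    have h2 := Nat.div_add_mod (n * j) M
    have h3 := Nat.mod_lt (n * i) hM
    have h4 := Nat.mod_lt (n * j) hM
    simp only at hij
    rw [hij] at h1
    zify at h1 h2 h3 h4
    have h5 : (M : ℤ) * c = (n * i : ℤ) % M - (n * j : ℤ) % M := by
      rw [← hc]; linear_combination h2 - h1
    have h6 := Int.emod_nonneg (n * i : ℤ) hM'.ne'
    have h7 := Int.emod_nonneg (n * j : ℤ) hM'.ne'
    have h8 : c = 0 := by
      have : (M : ℤ) * c < M * 1 := by linarith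
      have h9 := lt_of_mul_lt_mul_left this hM'.le
      have : (M : ℤ) * (-1) < M * c := by linarith
      have h10 := lt_of_mul_lt_mul_left this hM'.le
      omega
    rw [h8, mul_zero] at hc
    have : (n : ℤ) ≠ 0 := by exact_mod_cast hn.ne'
    have := (mul_eq_zero.1 hc).resolve_right this
    omega

theorem exists_avoiding {M n L q : ℕ} (hM : 0 < M) (hL : 0 < L) (hn : 0 < n) (a₀ : ℤ)
    (E : Finset ℕ) (B : Finset ℤ)
    (hE : ∀ e ∈ E, ∀ d : ℤ, (L * M : ℤ) ∣ d * L * ((q : ℤ) ^ e - 1) → (M : ℤ) ∣ d * n)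
    (hcard : E.card * n + B.card < M) :
    ∃ j : ℕ, (∀ e ∈ E, ¬ (L * M : ℤ) ∣ (a₀ + j * L) * ((q : ℤ) ^ e - 1)) ∧
      ∀ b ∈ B, ¬ (L * M : ℤ) ∣ (a₀ + j * L) - b := by
  classical
  by_contra! hcon
  have hL' : (L : ℤ) ≠ 0 := by exact_mod_cast hL.ne'
  have hsub : Finset.range M ⊆
      (E.biUnion fun e => {j ∈ Finset.range M |
        (L * M : ℤ) ∣ (a₀ + (j : ℕ) * L) * ((q : ℤ) ^ e - 1)}) ∪
      B.biUnion fun b => {j ∈ Finset.range M | (L * M : ℤ) ∣ (a₀ + (j : ℕ) * L) - b} := by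
    intro j hj
    by_cases h : ∀ e ∈ E, ¬ (L * M : ℤ) ∣ (a₀ + j * L) * ((q : ℤ) ^ e - 1)
    · obtain ⟨b, hb, hjb⟩ := hcon j h
      exact Finset.mem_union_right _ (Finset.mem_biUnion.2 ⟨b, hb, Finset.mem_filter.2 ⟨hj, hjb⟩⟩)
    · rw [not_forall₂] at h
      simp only [not_not] at h
      obtain ⟨e, he, hje⟩ := h
      exact Finset.mem_union_left _ (Finset.mem_biUnion.2 ⟨e, he, Finset.mem_filter.2 ⟨hj, hje⟩⟩)
  have h1 := (Finset.card_le_card hsub).trans (Finset.card_union_le _ _)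
  have h2 := Finset.card_biUnion_le_card_mul E
    (fun e => {j ∈ Finset.range M | (L * M : ℤ) ∣ (a₀ + (j : ℕ) * L) * ((q : ℤ) ^ e - 1)}) n
    fun e he => card_le_of_dvd_sub hM hn (Finset.filter_subset _ _) fun i hi j hj => by
      refine hE e he _ ?_
      have h3 : ((i : ℤ) - j) * L * ((q : ℤ) ^ e - 1) =
        (a₀ + i * L) * ((q : ℤ) ^ e - 1) - (a₀ + j * L) * ((q : ℤ) ^ e - 1) := by ring
      exact h3 ▸ dvd_sub (Finset.mem_filter.1 hi).2 (Finset.mem_filter.1 hj).2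
  have h3 := Finset.card_biUnion_le_card_mul B
    (fun b => {j ∈ Finset.range M | (L * M : ℤ) ∣ (a₀ + (j : ℕ) * L) - b}) 1
    fun b hb => card_le_of_dvd_sub hM one_pos (Finset.filter_subset _ _) fun i hi j hj => by
      refine (mul_dvd_mul_iff_left hL').1 ?_
      have h3 : (L : ℤ) * (((i : ℤ) - j) * (1 : ℕ)) = (a₀ + i * L - b) - (a₀ + j * L - b) := by
        push_cast; ring
      exact h3 ▸ dvd_sub (Finset.mem_filter.1 hi).2 (Finset.mem_filter.1 hj).2
  rw [Finset.card_range] at h1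
  omega

theorem sq_le_three_pow_totient {n : ℕ} (hn : Odd n) : n ^ 2 ≤ 3 ^ n.totient := by
  induction n using Nat.recOnPosPrimePosCoprime with
  | zero => simp at hn
  | one => simp
  | prime_pow p r hp hr =>
    have h3 : 3 ≤ p := by
      have := hp.two_le
      have : p ≠ 2 := fun h => by
        rw [h, Nat.odd_pow_iff hr.ne'] at hn
        exact absurd hn (by decide)
      omega
    have h1 : p ^ 2 ≤ 3 ^ (p - 1) := by
      obtain ⟨m, rfl⟩ := Nat.exists_eq_add_of_le h3
      clear hp hn h3
      rw [show 3 + m - 1 = m + 2 by omega]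
      induction m with
      | zero => norm_num
      | succ m ih =>
        rw [show m + 1 + 2 = (m + 2) + 1 by ring, pow_succ 3]
        generalize 3 ^ (m + 2) = X at ih ⊢
        have : (3 + (m + 1)) ^ 2 ≤ (3 + m) ^ 2 * 3 := by ring_nf; omega
        exact this.trans (Nat.mul_le_mul_right _ ih)
    rw [Nat.totient_prime_pow hp hr, ← pow_mul, mul_comm r, pow_mul]
    refine (Nat.pow_le_pow_left h1 r).trans ?_
    rw [← pow_mul, mul_comm]
    refine Nat.pow_le_pow_right (by norm_num) (Nat.mul_le_mul_right _ ?_)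
    have := Nat.lt_pow_self (n := r - 1) hp.one_lt
    omega
  | coprime a b ha hb hab iha ihb =>
    have hoa := (Nat.odd_mul.1 hn).1
    have hob := (Nat.odd_mul.1 hn).2
    rw [Nat.totient_mul hab, mul_pow]
    refine (Nat.mul_le_mul (iha hoa) (ihb hob)).trans ?_
    rw [← pow_add]
    refine Nat.pow_le_pow_right (by norm_num) ?_
    have h2 : ∀ c, 1 < c → Odd c → 2 ≤ c.totient := fun c hc ho => by
      have h3 : 2 < c := by
        rcases ho with ⟨t, rfl⟩
        omega
      have h4 := Nat.totient_even h3
      have h5 := Nat.totient_pos.2 (by omega : 0 < c)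
      rcases h4 with ⟨t, ht⟩
      omega
    nlinarith [h2 a ha hoa, h2 b hb hob]

theorem pow_mul_modEq {N q n r : ℕ} (hN : (N : ℤ) ∣ (q : ℤ) ^ n - 1) (hr : r ≤ n) {a b : ℤ}
    (h : (N : ℤ) ∣ a * (q : ℤ) ^ r - b) : (N : ℤ) ∣ a - b * (q : ℤ) ^ (n - r) := by
  have h1 := dvd_mul_of_dvd_left h ((q : ℤ) ^ (n - r))
  have h2 := dvd_mul_of_dvd_right hN a
  have h3 : (q : ℤ) ^ n = q ^ r * q ^ (n - r) := by rw [← pow_add, Nat.add_sub_cancel' hr]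
  rw [h3] at h2
  have h4 : a - b * (q : ℤ) ^ (n - r) = (a * (q : ℤ) ^ r - b) * (q : ℤ) ^ (n - r) -
    a * ((q : ℤ) ^ r * (q : ℤ) ^ (n - r) - 1) := by ring
  exact h4 ▸ dvd_sub h1 h2

theorem gcd_dvd {N q n r : ℕ} (hq : 2 ≤ q) (hr : 0 < r) (hrn : r < n)
    (hN : (N : ℤ) = (q : ℤ) ^ n - 1) {a : ℤ}
    (h : (N : ℤ) ∣ a * (q : ℤ) ^ r - a) :
    ∃ e ∈ n.properDivisors, (N : ℤ) ∣ a * ((q : ℤ) ^ e - 1) := by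
  refine ⟨n.gcd r, Nat.mem_properDivisors.2 ⟨Nat.gcd_dvd_left _ _,
    (Nat.le_of_dvd hr (Nat.gcd_dvd_right _ _)).trans_lt hrn⟩, ?_⟩
  have h1 := Nat.pow_sub_one_gcd_pow_sub_one q n r
  have hc : ∀ m : ℕ, ((q ^ m - 1 : ℕ) : ℤ) = (q : ℤ) ^ m - 1 := fun m => by
    rw [Nat.cast_sub (Nat.one_le_pow _ _ (by omega))]; push_cast; rfl
  have hN' : N = q ^ n - 1 := by zify; rw [hN, hc]
  rw [← hc, ← h1, ← hN', Nat.gcd_eq_gcd_ab, hc]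
  have h2 : a * ((N : ℤ) * N.gcdA (q ^ r - 1) + ((q : ℤ) ^ r - 1) * N.gcdB (q ^ r - 1)) =
    N * (a * N.gcdA (q ^ r - 1)) + (a * (q : ℤ) ^ r - a) * N.gcdB (q ^ r - 1) := by ring
  rw [h2]
  exact dvd_add (dvd_mul_right _ _) (dvd_mul_of_dvd_left h _)


open Polynomial in
theorem sub_one_mul_cyclotomic_dvd {q n e : ℕ} (he : e ∈ n.properDivisors) :
    ((q : ℤ) ^ e - 1) * (cyclotomic n ℤ).eval (q : ℤ) ∣ (q : ℤ) ^ n - 1 := by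
  have := map_dvd (evalRingHom (q : ℤ)) (X_pow_sub_one_mul_cyclotomic_dvd_X_pow_sub_one_of_dvd ℤ he)
  simpa using this

open Polynomial in
theorem dvd_mul_of_dvd_mul_sub_one {q n e : ℕ} (hq : 2 ≤ q) (he : e ∈ n.properDivisors) {d : ℤ}
    (h : (cyclotomic n ℤ).eval (q : ℤ) ∣ d * ((q : ℤ) ^ e - 1)) :
    (cyclotomic n ℤ).eval (q : ℤ) ∣ d * n := by
  obtain ⟨⟨m, rfl⟩, hlt⟩ := Nat.mem_properDivisors.1 he
  have he0 : 0 < e := by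
    rcases Nat.eq_zero_or_pos e with rfl | h
    · simp at hlt
    · exact h
  have hne : ((q : ℤ) ^ e - 1) ≠ 0 := by
    have : 1 < (q : ℤ) ^ e := one_lt_pow₀ (by exact_mod_cast hq) he0.ne'
    omega
  have h1 : (cyclotomic (e * m) ℤ).eval (q : ℤ) ∣ ∑ i ∈ Finset.range m, ((q : ℤ) ^ e) ^ i := by
    refine (mul_dvd_mul_iff_left hne).1 ((sub_one_mul_cyclotomic_dvd he).trans ?_)
    rw [mul_geom_sum, ← pow_mul]
  have h2 : ((q : ℤ) ^ e - 1) ∣ (∑ i ∈ Finset.range m, ((q : ℤ) ^ e) ^ i) - m := by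
    have : (∑ i ∈ Finset.range m, ((q : ℤ) ^ e) ^ i) - m =
        ∑ i ∈ Finset.range m, (((q : ℤ) ^ e) ^ i - 1) := by simp
    rw [this]
    exact Finset.dvd_sum fun i _ => sub_one_dvd_pow_sub_one _ _
  obtain ⟨t, ht⟩ := h2
  have h3 : d * ((e * m : ℕ) : ℤ) = e * (d * (∑ i ∈ Finset.range m, ((q : ℤ) ^ e) ^ i) -
      (d * ((q : ℤ) ^ e - 1)) * t) := by
    push_cast
    linear_combination (-(e * d : ℤ)) * ht
  rw [h3]
  exact dvd_mul_of_dvd_right (dvd_sub (dvd_mul_of_dvd_right h1 _) (dvd_mul_of_dvd_left h _)) _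

open Polynomial in
/-- The exponents of three characters of the multiplicative group of a field with `q ^ n`
elements, `q = q₀ ^ 2`: they are regular, pairwise not conjugate, agree on proper subfields, and the
first one is conjugate-selfdual. -/
theorem exists_exponents {q₀ n : ℕ} (hq₀ : 2 ≤ q₀) (hn : Odd n) (hn3 : 3 ≤ n) :
    ∃ a : Fin 3 → ℕ, a 0 = q₀ ^ n - 1 ∧
      (∀ e ∈ n.properDivisors, ∀ x, (((q₀ ^ 2 : ℕ) : ℤ) ^ e - 1) ∣ (a x : ℤ) - a 0) ∧
      ∀ x y, ∀ r < n, (((q₀ ^ 2 : ℕ) : ℤ) ^ n - 1) ∣ a x * ((q₀ ^ 2 : ℕ) : ℤ) ^ r - a y →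
        x = y ∧ r = 0 := by
  set q := q₀ ^ 2 with hqdef
  have hq : 4 ≤ q := by nlinarith
  have hn2 := sq_le_three_pow_totient hn
  set Φ := (cyclotomic n ℤ).eval (q : ℤ) with hΦ
  have hΦpos : 0 < Φ := cyclotomic_pos' n (by exact_mod_cast (by omega : 1 < q))
  have hΦlt : (n : ℤ) ^ 2 < Φ := by
    have h1 := sub_one_pow_totient_lt_cyclotomic_eval (n := n) (q := (q : ℝ)) (by omega)
      (by exact_mod_cast (by omega : 1 < q))
    have h2 : (cyclotomic n ℝ).eval (q : ℝ) = ((Φ : ℤ) : ℝ) := by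
      rw [hΦ, ← map_cyclotomic_int, show (q : ℝ) = ((q : ℤ) : ℝ) by simp, eval_intCast_map]
      simp
    have h3 : (3 : ℝ) ^ n.totient ≤ ((q : ℝ) - 1) ^ n.totient := by
      refine pow_le_pow_left₀ (by norm_num) ?_ _
      have : (4 : ℝ) ≤ q := by exact_mod_cast hq
      linarith
    have h4 : ((n : ℝ)) ^ 2 ≤ 3 ^ n.totient := by exact_mod_cast hn2
    have : ((n : ℝ)) ^ 2 < ((Φ : ℤ) : ℝ) := by rw [← h2]; linarith
    exact_mod_cast this
  obtain ⟨M, hM⟩ := Int.eq_ofNat_of_zero_le hΦpos.le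
  have hNpos : 0 < (q : ℤ) ^ n - 1 := by
    have : 1 < (q : ℤ) ^ n := one_lt_pow₀ (by exact_mod_cast (by omega : 1 < q)) (by omega)
    omega
  have h1div : 1 ∈ n.properDivisors := Nat.mem_properDivisors.2 ⟨one_dvd _, by omega⟩
  obtain ⟨Λ, hΛ⟩ : Φ ∣ (q : ℤ) ^ n - 1 :=
    (dvd_mul_left _ _).trans (sub_one_mul_cyclotomic_dvd h1div)
  have hΛpos : 0 < Λ := by
    rw [hΛ] at hNpos
    exact pos_of_mul_pos_right hNpos hΦpos.le
  obtain ⟨L, hL⟩ := Int.eq_ofNat_of_zero_le hΛpos.le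
  have hN : ((L * M : ℕ) : ℤ) = (q : ℤ) ^ n - 1 := by rw [hΛ, hM, hL]; push_cast; ring
  have hM0 : 0 < M := by omega
  have hL0 : 0 < L := by omega
  have hLdvd : ∀ e ∈ n.properDivisors, ((q : ℤ) ^ e - 1) ∣ L := fun e he => by
    have := sub_one_mul_cyclotomic_dvd (q := q) he
    rw [hΛ, mul_comm, ← hΦ] at this
    rw [← hL] 
    exact (mul_dvd_mul_iff_left hΦpos.ne').1 this
  have havoid := fun (a₀ : ℤ) (B : Finset ℤ) (hB : B.card ≤ 2 * n) =>
    exists_avoiding (q := q) hM0 hL0 (by omega : 0 < n) a₀ n.properDivisors B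
      (fun e he d h => by
        rw [← hM]
        refine dvd_mul_of_dvd_mul_sub_one (by omega) he ?_
        rw [← hΦ, hM]
        refine (mul_dvd_mul_iff_left (by exact_mod_cast hL0.ne' : (L : ℤ) ≠ 0)).1 ?_
        have h3 : (L : ℤ) * (d * ((q : ℤ) ^ e - 1)) = d * L * ((q : ℤ) ^ e - 1) := by ring
        exact h3 ▸ h)
      (by
        have h1 : n.properDivisors.card ≤ n / 2 := by
          have : n.properDivisors ⊆ Finset.Icc 1 (n / 2) := fun e he => by
            obtain ⟨⟨m, hm⟩, hlt⟩ := Nat.mem_properDivisors.1 he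
            rw [Finset.mem_Icc]
            have : e ≠ 0 := by rintro rfl; omega
            have : m ≠ 0 := by rintro rfl; omega
            have : m ≠ 1 := by rintro rfl; omega
            have : 2 ≤ m := by omega
            refine ⟨by omega, (Nat.le_div_iff_mul_le two_pos).2 ?_⟩
            rw [hm]
            exact Nat.mul_le_mul_left _ this
          simpa using Finset.card_le_card this
        have h2 : n ^ 2 < M := by rw [hM] at hΦlt; exact_mod_cast hΦlt
        have h3 : 2 * (n / 2) + 1 = n := by rcases hn with ⟨t, rfl⟩; omega
        nlinarith)
  have hreg : ∀ a : ℤ, (∀ e ∈ n.properDivisors, ¬ ((L * M : ℕ) : ℤ) ∣ a * ((q : ℤ) ^ e - 1)) →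
      ∀ r < n, ((L * M : ℕ) : ℤ) ∣ a * (q : ℤ) ^ r - a → r = 0 := by
    intro a ha r hr h
    by_contra h0
    obtain ⟨e, he, h'⟩ := gcd_dvd (by omega) (Nat.pos_of_ne_zero h0) hr hN h
    exact ha e he h'
  have hsep : ∀ a b : ℤ, (∀ r < n, ¬ ((L * M : ℕ) : ℤ) ∣ a - b * (q : ℤ) ^ r) → ∀ r < n,
      ¬ ((L * M : ℕ) : ℤ) ∣ b * (q : ℤ) ^ r - a ∧ ¬ ((L * M : ℕ) : ℤ) ∣ a * (q : ℤ) ^ r - b := by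
    refine fun a b h r hr => ⟨fun h' => h r hr ?_, fun h' => ?_⟩
    · rw [← neg_sub]; exact h'.neg_right
    · rcases Nat.eq_zero_or_pos r with rfl | hr0
      · exact h 0 hr (by simpa using h')
      · exact h (n - r) (by omega) (pow_mul_modEq (hN ▸ dvd_rfl) hr.le h')
  have ha₀ : ∀ e ∈ n.properDivisors,
      ¬ ((L * M : ℕ) : ℤ) ∣ ((q₀ ^ n - 1 : ℕ) : ℤ) * ((q : ℤ) ^ e - 1) := by
    intro e he h
    obtain ⟨⟨m, hm⟩, hlt⟩ := Nat.mem_properDivisors.1 he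
    have he0 : e ≠ 0 := by rintro rfl; omega
    have h2e : 2 * e ≤ n := by
      have : m ≠ 0 := by rintro rfl; omega
      have : m ≠ 1 := by rintro rfl; omega
      rw [hm, mul_comm]
      exact Nat.mul_le_mul_left _ (by omega)
    have hc : ((q₀ ^ n - 1 : ℕ) : ℤ) = (q₀ : ℤ) ^ n - 1 := by
      rw [Nat.cast_sub (Nat.one_le_pow _ _ (by omega))]; push_cast; rfl
    have h1 : 1 < (q₀ : ℤ) ^ n := one_lt_pow₀ (by exact_mod_cast (by omega : 1 < q₀)) (by omega)
    have h2 : 1 < (q₀ : ℤ) ^ (2 * e) :=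
      one_lt_pow₀ (by exact_mod_cast (by omega : 1 < q₀)) (by omega)
    have h3 : (q₀ : ℤ) ^ (2 * e) ≤ (q₀ : ℤ) ^ n :=
      pow_le_pow_right₀ (by exact_mod_cast (by omega : 1 ≤ q₀)) h2e
    have hqn : (q : ℤ) ^ n - 1 = ((q₀ : ℤ) ^ n - 1) * ((q₀ : ℤ) ^ n + 1) := by
      rw [hqdef]; push_cast; ring
    have hqe : (q : ℤ) ^ e - 1 = (q₀ : ℤ) ^ (2 * e) - 1 := by
      rw [hqdef]; push_cast; rw [← pow_mul]
    rw [hN, hc, hqn, hqe] at h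
    have := Int.le_of_dvd (by omega) ((mul_dvd_mul_iff_left (by omega)).1 h)
    omega
  obtain ⟨j₁, hj₁, hb₁⟩ := havoid ((q₀ ^ n - 1 : ℕ) : ℤ)
    ((Finset.range n).image fun r => ((q₀ ^ n - 1 : ℕ) : ℤ) * (q : ℤ) ^ r)
    (Finset.card_image_le.trans (by rw [Finset.card_range]; omega))
  obtain ⟨j₂, hj₂, hb₂⟩ := havoid ((q₀ ^ n - 1 : ℕ) : ℤ)
    (((Finset.range n).image fun r => ((q₀ ^ n - 1 : ℕ) : ℤ) * (q : ℤ) ^ r) ∪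
      (Finset.range n).image fun r => (((q₀ ^ n - 1 : ℕ) : ℤ) + j₁ * L) * (q : ℤ) ^ r)
    ((Finset.card_union_le _ _).trans (by
      have h1 := Finset.card_image_le (s := Finset.range n)
        (f := fun r => ((q₀ ^ n - 1 : ℕ) : ℤ) * (q : ℤ) ^ r)
      have h2 := Finset.card_image_le (s := Finset.range n)
        (f := fun r => (((q₀ ^ n - 1 : ℕ) : ℤ) + j₁ * L) * (q : ℤ) ^ r)
      rw [Finset.card_range] at h1 h2
      omega))
  have hcast : ((L * M : ℕ) : ℤ) = (L * M : ℤ) := by push_cast; rfl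
  rw [← hcast] at hj₁ hb₁ hj₂ hb₂
  have s10 := hsep (((q₀ ^ n - 1 : ℕ) : ℤ) + j₁ * L) ((q₀ ^ n - 1 : ℕ) : ℤ) fun r hr =>
    hb₁ _ (Finset.mem_image_of_mem _ (Finset.mem_range.2 hr))
  have s20 := hsep (((q₀ ^ n - 1 : ℕ) : ℤ) + j₂ * L) ((q₀ ^ n - 1 : ℕ) : ℤ) fun r hr =>
    hb₂ _ (Finset.mem_union_left _ (Finset.mem_image_of_mem _ (Finset.mem_range.2 hr)))
  have s21 := hsep (((q₀ ^ n - 1 : ℕ) : ℤ) + j₂ * L) (((q₀ ^ n - 1 : ℕ) : ℤ) + j₁ * L) fun r hr =>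
    hb₂ _ (Finset.mem_union_right _ (Finset.mem_image_of_mem
      (fun r => (((q₀ ^ n - 1 : ℕ) : ℤ) + j₁ * L) * (q : ℤ) ^ r) (Finset.mem_range.2 hr)))
  refine ⟨![q₀ ^ n - 1, q₀ ^ n - 1 + j₁ * L, q₀ ^ n - 1 + j₂ * L], rfl, fun e he x => ?_,
    fun x y r hr h => ?_⟩
  · have hd := hLdvd e he
    fin_cases x
    · simp
    · simpa using dvd_mul_of_dvd_right hd _
    · simpa using dvd_mul_of_dvd_right hd _
  · rw [← hN] at h
    have hc : ∀ j : ℕ, ((q₀ ^ n - 1 + j * L : ℕ) : ℤ) = ((q₀ ^ n - 1 : ℕ) : ℤ) + j * L :=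
      fun j => by rw [Nat.cast_add, Nat.cast_mul]
    fin_cases x <;> fin_cases y <;>
      simp only [Fin.zero_eta, Fin.mk_one, Fin.reduceFinMk, Matrix.cons_val, hc] at h
    · exact ⟨rfl, hreg _ ha₀ r hr h⟩
    · exact absurd h (s10 r hr).1
    · exact absurd h (s20 r hr).1
    · exact absurd h (s10 r hr).2
    · exact ⟨rfl, hreg _ hj₁ r hr h⟩
    · exact absurd h (s21 r hr).1
    · exact absurd h (s20 r hr).2
    · exact absurd h (s21 r hr).2
    · exact ⟨rfl, hreg _ hj₂ r hr h⟩

end RegularExponents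

namespace FiniteFieldTower

/-- A quadratic automorphism of a finite field is raising to the power of the cardinality of the
fixed field. -/
theorem apply_eq_pow_card {k₀ k : Type} [Field k₀] [Fintype k₀] [Field k] [Fintype k]
    [Algebra k₀ k] (hquad : Module.finrank k₀ k = 2) (σ : k ≃ₐ[k₀] k) (hσ : σ ≠ AlgEquiv.refl)
    (c : k) : σ c = c ^ Fintype.card k₀ := by
  obtain ⟨⟨r, hr⟩, h⟩ := (FiniteField.bijective_frobeniusAlgEquivOfAlgebraic_pow k₀ k).2 σ
  rw [hquad] at hr
  simp only at h
  interval_cases r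
  · exact absurd (by rw [← h, pow_zero]; rfl) hσ
  · rw [← h, pow_one, FiniteField.frobeniusAlgEquivOfAlgebraic_apply]

/-- The extension of odd degree `n` of the larger field of a quadratic extension of finite fields
has an automorphism extending the quadratic one, namely raising to the power `q₀ ^ n`. -/
theorem exists_field (p : ℕ) [Fact p.Prime] (k₀ k : Type) [Field k₀] [Fintype k₀] [Field k]
    [Fintype k] [CharP k p] [Algebra k₀ k] (hquad : Module.finrank k₀ k = 2) (σ : k ≃ₐ[k₀] k)
    (hσ : σ ≠ AlgEquiv.refl) (n : ℕ) (hn : Odd n) :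
    ∃ (K : Type) (_ : Field K) (_ : Finite K) (_ : Algebra k K) (φ : K ≃+* K),
      Module.finrank k K = n ∧ (∀ x, φ x = x ^ Fintype.card k₀ ^ n) ∧
      ∀ c, φ (algebraMap k K c) = algebraMap k K (σ c) := by
  have : NeZero n := ⟨hn.pos.ne'⟩
  have hk₀ : CharP k₀ p := (algebraMap k₀ k).charP (algebraMap k₀ k).injective p
  obtain ⟨f, -, hf⟩ := FiniteField.card k₀ p
  have hK : CharP (FiniteField.Extension k p n) p :=
    charP_of_injective_algebraMap (algebraMap k _).injective p
  have hex : ExpChar (FiniteField.Extension k p n) p := ExpChar.prime Fact.out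
  have hφ : ∀ x, iterateFrobeniusEquiv (FiniteField.Extension k p n) p (f * n) x =
      x ^ Fintype.card k₀ ^ n := fun x => by
    rw [iterateFrobeniusEquiv_def, hf, pow_mul]
  refine ⟨FiniteField.Extension k p n, inferInstance, inferInstance, inferInstance,
    iterateFrobeniusEquiv _ p (f * n), FiniteField.finrank_extension k p n, hφ, fun c => ?_⟩
  rw [hφ, ← map_pow, apply_eq_pow_card hquad σ hσ]
  obtain ⟨m, rfl⟩ := hn
  have hcard : Fintype.card k = Fintype.card k₀ ^ 2 := by
    rw [Module.card_eq_pow_finrank (K := k₀), hquad]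
  rw [pow_succ, pow_mul, pow_mul (Fintype.card k₀) 2 m, ← hcard, FiniteField.pow_card_pow]

variable {k K : Type} [Field k] [Fintype k] [Field K] [Finite K] [Algebra k K]

/-- An element of a finite extension generating a proper subextension lies in a field with
`q ^ e` elements, for a proper divisor `e` of the degree. -/
theorem exists_pow_eq_one_of_adjoin_ne_top (x : Kˣ) (hx : Algebra.adjoin k {(x : K)} ≠ ⊤) :
    ∃ e ∈ (Module.finrank k K).properDivisors, x ^ (Fintype.card k ^ e - 1) = 1 := by
  have hfin : FiniteDimensional k K := Module.Finite.of_finite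
  have hK := IntermediateField.adjoin_simple_toSubalgebra_of_isAlgebraic
    (Algebra.IsAlgebraic.isAlgebraic (R := k) (x : K))
  let F := IntermediateField.adjoin k {(x : K)}
  have hmul := Module.finrank_mul_finrank k F K
  have hpos : 0 < Module.finrank k K := Module.finrank_pos
  refine ⟨Module.finrank k F, Nat.mem_properDivisors.2 ⟨⟨_, hmul.symm⟩, ?_⟩, ?_⟩
  · refine lt_of_le_of_ne (Nat.le_of_dvd hpos ⟨_, hmul.symm⟩) fun h => hx ?_
    rw [h] at hmul
    have hF : F = ⊤ := IntermediateField.finrank_eq_one_iff_eq_top.1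
      (Nat.eq_of_mul_eq_mul_left hpos (by rw [hmul, mul_one]))
    rw [← hK, show IntermediateField.adjoin k {(x : K)} = ⊤ from hF,
      IntermediateField.top_toSubalgebra]
  · have : Fintype F := Fintype.ofFinite F
    let y : F := ⟨x, IntermediateField.mem_adjoin_simple_self k (x : K)⟩
    have hy : y ≠ 0 := fun h => x.ne_zero (congrArg Subtype.val h)
    have h1 := FiniteField.pow_card_sub_one_eq_one y hy
    rw [Module.card_eq_pow_finrank (K := k)] at h1
    exact Units.ext (by simpa [y] using congrArg Subtype.val h1)

/-- Three characters of the multiplicative group of a finite field which agree on nongenerating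
elements, have trivial stabilisers and pairwise distinct orbits under the Galois group, and the
first of which is inverted by `φ`. -/
theorem exists_characters {q₀ n : ℕ} (hq₀ : 2 ≤ q₀) (hn : Odd n) (hn3 : 3 ≤ n)
    (hcard : Fintype.card k = q₀ ^ 2) (hfr : Module.finrank k K = n) (φ : K ≃+* K)
    (hφ : ∀ x, φ x = x ^ q₀ ^ n) (R : Type) [Field R] [IsAlgClosed R] [CharZero R] :
    ∃ θ : Fin 3 → (Kˣ →* Rˣ),
      (∀ x : Kˣ, Algebra.adjoin k {(x : K)} ≠ ⊤ → ∀ i j, θ i x = θ j x) ∧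
      (∀ i j (ψ : K ≃ₐ[k] K), (∀ x, θ i (Units.map (ψ : K →* K) x) = θ j x) → i = j ∧ ψ = 1) ∧
      ∀ x, θ 0 (Units.map (φ : K →* K) x) = (θ 0 x)⁻¹ := by
  have : Fintype K := Fintype.ofFinite K
  have hfin : FiniteDimensional k K := Module.Finite.of_finite
  have hcK : Fintype.card K = (q₀ ^ 2) ^ n := by
    rw [Module.card_eq_pow_finrank (K := k), hfr, hcard]
  obtain ⟨g, hg⟩ := IsCyclic.exists_generator (α := Kˣ)
  have hN : Nat.card Kˣ = (q₀ ^ 2) ^ n - 1 := by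
    rw [Nat.card_units, Nat.card_eq_fintype_card, hcK]
  have hNpos : 0 < Nat.card Kˣ := Nat.card_pos
  have hNR : NeZero ((Nat.card Kˣ : ℕ) : R) := ⟨by exact_mod_cast hNpos.ne'⟩
  have hogN : orderOf g = Nat.card Kˣ := orderOf_eq_card_of_forall_mem_zpowers hg
  obtain ⟨ζ, hζ⟩ := HasEnoughRootsOfUnity.exists_primitiveRoot R (Nat.card Kˣ)
  have hζ' : IsPrimitiveRoot (hζ.isUnit hNpos.ne').unit (Nat.card Kˣ) :=
    hζ.isUnit_unit hNpos.ne'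
  set z := (hζ.isUnit hNpos.ne').unit
  have hz : orderOf z = Nat.card Kˣ := hζ'.eq_orderOf.symm
  let Θ := monoidHomOfForallMemZpowers hg (g' := z) (by rw [hz, hogN])
  have hΘ : Θ g = z := monoidHomOfForallMemZpowers_apply_gen hg _
  have hNZ : (((q₀ ^ 2 : ℕ) : ℤ) ^ n - 1) = (Nat.card Kˣ : ℤ) := by
    rw [hN, Nat.cast_sub (Nat.one_le_pow _ _ (by positivity))]
    push_cast; ring
  obtain ⟨a, ha0, hprop, hreg⟩ := RegularExponents.exists_exponents hq₀ hn hn3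
  refine ⟨fun i => Θ ^ a i, fun x hx i j => ?_, fun i j ψ h => ?_, fun x => ?_⟩
  · obtain ⟨e, he, hxe⟩ := exists_pow_eq_one_of_adjoin_ne_top (k := k) x hx
    rw [hfr] at he
    rw [hcard] at hxe
    have key : ∀ i, (Θ ^ a i) x = (Θ ^ a 0) x := fun i => by
      obtain ⟨c, hc⟩ := hprop e he i
      have h1 : (Θ x) ^ (((q₀ ^ 2 : ℕ) : ℤ) ^ e - 1) = 1 := by
        have h2 : (((q₀ ^ 2 : ℕ) : ℤ) ^ e - 1) = (((q₀ ^ 2) ^ e - 1 : ℕ) : ℤ) := by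
          rw [Nat.cast_sub (Nat.one_le_pow _ _ (by positivity))]
          push_cast; ring
        rw [h2, zpow_natCast, ← map_pow, hxe, map_one]
      have h3 : (a i : ℤ) = a 0 + (((q₀ ^ 2 : ℕ) : ℤ) ^ e - 1) * c := by linarith
      rw [MonoidHom.pow_apply, MonoidHom.pow_apply, ← zpow_natCast, h3, _root_.zpow_add,
        _root_.zpow_mul, h1,
        _root_.one_zpow, mul_one, zpow_natCast]
    rw [key i, key j]
  · obtain ⟨⟨r, hr⟩, rfl⟩ := (FiniteField.bijective_frobeniusAlgEquivOfAlgebraic_pow k K).2 ψ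
    simp only at h ⊢
    have hfrob : ∀ x : Kˣ, Units.map (((FiniteField.frobeniusAlgEquivOfAlgebraic k K ^ r :
        K ≃ₐ[k] K) : K →* K)) x = x ^ (q₀ ^ 2) ^ r := fun x => by
      ext
      simp only [Units.coe_map, Units.val_pow_eq_pow_val, ← hcard]
      have := congrFun (FiniteField.coe_frobeniusAlgEquivOfAlgebraic_iterate k K r) (x : K)
      rw [← this]
      simp [AlgEquiv.coe_pow]
    have hgg := h g
    rw [hfrob, map_pow, MonoidHom.pow_apply, MonoidHom.pow_apply, hΘ, ← pow_mul] at hgg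
    have hd : (Nat.card Kˣ : ℤ) ∣ (a i : ℤ) * ((q₀ ^ 2 : ℕ) : ℤ) ^ r - a j := by
      rw [← hz, orderOf_dvd_iff_zpow_eq_one, _root_.zpow_sub, mul_inv_eq_one]
      exact_mod_cast hgg
    rw [hfr] at hr
    obtain ⟨h1, h2⟩ := hreg i j r hr (hNZ ▸ hd)
    exact ⟨h1, by rw [h2, pow_zero]⟩
  · have h1 : Units.map (φ : K →* K) x = x ^ q₀ ^ n := Units.ext (by simp [hφ])
    rw [h1, MonoidHom.pow_apply, MonoidHom.pow_apply, ha0, map_pow, eq_inv_iff_mul_eq_one,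
      ← mul_pow, ← pow_succ, ← map_pow, ← map_pow, ← pow_mul]
    have h4 : (q₀ ^ n + 1) * (q₀ ^ n - 1) = Nat.card Kˣ := by
      rw [hN, ← Nat.sq_sub_sq]; congr 1; ring
    rw [h4, pow_card_eq_one', map_one]

end FiniteFieldTower

namespace RegularTorus

open MatrixSplitting

variable {k K : Type} [Field k] [Field K] [Algebra k K]

/-- The multiplication action of `Kˣ` on the `k`-vector space `K`. -/
def torus (k K : Type) [Field k] [Field K] [Algebra k K] : Kˣ →* (K ≃ₗ[k] K) :=
  DistribMulAction.toModuleAut k K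

theorem torus_apply (t : Kˣ) (v : K) : torus k K t v = t * v := rfl

theorem apply_mul_of_torus_mul_mul_torus {g z : K ≃ₗ[k] K} {t : Kˣ}
    (h : g * z * torus k K t = z) (v : K) : g (z (t * v)) = z v :=
  LinearEquiv.congr_fun h v

/-- A linear automorphism conjugate to multiplication by a generator has no nontrivial stable
subspace. -/
theorem adjoin_ne_top_of_stable [Finite K] {g z : K ≃ₗ[k] K} {t : Kˣ}
    (h : g * z * torus k K t = z) {X : Submodule k K} (hX : X ≠ ⊥) (hX' : X ≠ ⊤)
    (hg : ∀ v ∈ X, g v ∈ X) : Algebra.adjoin k {(t : K)} ≠ ⊤ := by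
  intro htop
  have hfin : FiniteDimensional k K := Module.Finite.of_finite
  let T : Subalgebra k K :=
    { carrier := {c | ∀ v, z v ∈ X → z (c * v) ∈ X}
      mul_mem' := fun {a b} ha hb v hv => by rw [mul_assoc]; exact ha _ (hb _ hv)
      add_mem' := fun {a b} ha hb v hv => by
        rw [add_mul, map_add]; exact X.add_mem (ha _ hv) (hb _ hv)
      algebraMap_mem' := fun c v hv => by
        rw [← Algebra.smul_def, map_smul]; exact X.smul_mem _ hv }
  have ht : (t : K)⁻¹ ∈ T := fun v hv => by
    have := apply_mul_of_torus_mul_mul_torus h ((t : K)⁻¹ * v)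
    rw [mul_inv_cancel_left₀ t.ne_zero] at this
    rw [← this]
    exact hg _ hv
  have ht' : (t : K) ∈ T := by
    have := Subalgebra.inv_mem_of_algebraic (A := T) (x := ⟨_, ht⟩)
      (Algebra.IsAlgebraic.isAlgebraic _)
    simpa using this
  have hT : T = ⊤ := top_le_iff.1 (htop ▸ Algebra.adjoin_le (by simpa using ht'))
  obtain ⟨y, hy, hy0⟩ := X.exists_mem_ne_zero_of_ne_bot hX
  refine hX' (Submodule.eq_top_iff'.2 fun w => ?_)
  have h1 : z.symm w * (z.symm y)⁻¹ ∈ T := hT ▸ Algebra.mem_top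
  have h2 := h1 (z.symm y) (by simpa using hy)
  rwa [inv_mul_cancel_right₀ (by simpa using hy0), z.apply_symm_apply] at h2

/-- A linear automorphism intertwining multiplications by two elements, one of which is a
generator, is the composition of a Galois automorphism and a multiplication. -/
theorem card_intertwiner [Finite K] (s t : Kˣ) (ht : Algebra.adjoin k {(t : K)} = ⊤) :
    Nat.card {z : K ≃ₗ[k] K // torus k K s * z * torus k K t = z} =
      Nat.card Kˣ * Nat.card {ψ : K ≃ₐ[k] K // Units.map (ψ : K →* K) t = s⁻¹} := by
  rw [← Nat.card_prod]
  symm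
  refine Nat.card_congr (Equiv.ofBijective (fun x => ⟨torus k K x.1 * x.2.1.toLinearEquiv, ?_⟩)
    ⟨fun x y hxy => ?_, fun z => ?_⟩)
  · refine LinearEquiv.ext fun v => ?_
    have h := congrArg Units.val x.2.2
    change (s : K) * (x.1 * (x.2.1 (t * v))) = x.1 * x.2.1 v
    have h' : x.2.1 (t : K) = (s : K)⁻¹ := by simpa using h
    rw [map_mul, h']
    field_simp
  · have h : ∀ v, (x.1 : K) * x.2.1 v = y.1 * y.2.1 v :=
      fun v => LinearEquiv.congr_fun (congrArg Subtype.val hxy) v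
    have h1 : x.1 = y.1 := Units.ext (by simpa using h 1)
    refine Prod.ext h1 (Subtype.ext (AlgEquiv.ext fun v => ?_))
    have := h v
    rw [h1] at this
    exact mul_left_cancel₀ y.1.ne_zero this
  · obtain ⟨z, hz⟩ := z
    have hz' : ∀ v, z (t * v) = (s : K)⁻¹ * z v := fun v => by
      have h : (s : K) * z (t * v) = z v := apply_mul_of_torus_mul_mul_torus hz v
      rw [← h, inv_mul_cancel_left₀ s.ne_zero]
    have hz1 : z 1 ≠ 0 := by simp
    let T : Subalgebra k K :=
      { carrier := {c | ∀ v, z (c * v) * z 1 = z c * z v}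
        mul_mem' := fun {a b} ha hb v => by
          refine mul_right_cancel₀ hz1 ?_
          have h1 := ha (b * v)
          have h2 := hb v
          have h3 := ha b
          rw [mul_assoc a b v, h1, mul_assoc, h2, ← mul_assoc, ← h3]
          ring
        add_mem' := fun {a b} ha hb v => by
          rw [add_mul, map_add, add_mul, ha, hb, map_add, add_mul]
        algebraMap_mem' := fun c v => by
          rw [← Algebra.smul_def, map_smul, Algebra.algebraMap_eq_smul_one, map_smul,
            smul_mul_assoc, smul_mul_assoc, mul_comm] }
    have htT : (t : K) ∈ T := fun v => by
      have h1 := hz' 1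
      rw [mul_one] at h1
      rw [hz', h1]
      ring
    have hT : T = ⊤ := top_le_iff.1 (ht ▸ Algebra.adjoin_le (by simpa using htT))
    have hmul : ∀ a v, z (a * v) * z 1 = z a * z v := fun a => 
      (hT ▸ Algebra.mem_top : a ∈ T)
    let ψ : K ≃ₐ[k] K := AlgEquiv.ofLinearEquiv
      (z.trans (torus k K (Units.mk0 (z 1) hz1)⁻¹))
      (by
        change ((Units.mk0 (z 1) hz1)⁻¹ : Kˣ) * z 1 = (1 : K)
        simp [hz1])
      (fun a v => by
        change ((Units.mk0 (z 1) hz1)⁻¹ : Kˣ) * z (a * v) =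
          (((Units.mk0 (z 1) hz1)⁻¹ : Kˣ) * z a) * ((((Units.mk0 (z 1) hz1)⁻¹ : Kˣ) : K) * z v)
        have := hmul a v
        simp only [Units.val_inv_eq_inv_val, Units.val_mk0]
        field_simp
        linear_combination this)
    have hψ : ∀ v, ψ v = (z 1)⁻¹ * z v := fun v => by
      change ((Units.mk0 (z 1) hz1)⁻¹ : Kˣ) * z v = _
      simp
    refine ⟨⟨Units.mk0 (z 1) hz1, ψ, Units.ext ?_⟩, Subtype.ext (LinearEquiv.ext fun v => ?_)⟩
    · have h1 := hz' 1
      rw [mul_one] at h1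
      simp only [Units.coe_map, MonoidHom.coe_coe, hψ, h1, Units.val_inv_eq_inv_val]
      field_simp
    · change z 1 * ψ v = z v
      rw [hψ, mul_inv_cancel_left₀ hz1]

section Orthogonality

variable {R : Type} [Field R]

/-- The element of the group algebra attached to a function on the torus. -/
noncomputable def torusSum (k : Type) {K R : Type} [Field k] [Field K] [Algebra k K] [Finite K]
    [Field R] (f : Kˣ → R) : MonoidAlgebra R (K ≃ₗ[k] K) :=
  (Nat.card Kˣ : R)⁻¹ • ∑ᶠ t, f t • MonoidAlgebra.of R _ (torus k K t)

variable [Finite K]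

theorem chi_torusSum [Fintype Kˣ] (F : MonoidAlgebra R (K ≃ₗ[k] K) →ₗ[R] R) (f : Kˣ → R) :
    F (torusSum k f) =
      (Nat.card Kˣ : R)⁻¹ * ∑ t, f t * F (MonoidAlgebra.of R _ (torus k K t)) := by
  rw [torusSum, finsum_eq_sum_of_fintype, map_smul, map_sum, smul_eq_mul]
  simp_rw [map_smul, smul_eq_mul]

variable (S : MatrixSplitting R (MonoidAlgebra R (K ≃ₗ[k] K)))

theorem sum_chi_of_mul_chi_torusSum_eq_zero (h : Kˣ → R)
    (hh : ∀ t : Kˣ, Algebra.adjoin k {(t : K)} ≠ ⊤ → h t = 0) {g : K ≃ₗ[k] K}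
    {X : Submodule k K} (hX : X ≠ ⊥) (hX' : X ≠ ⊤) (hg : ∀ v ∈ X, g v ∈ X) :
    ∑ l, S.chi l (MonoidAlgebra.of R _ g) * S.chi l (torusSum k h) = 0 := by
  have : Fintype Kˣ := Fintype.ofFinite _
  simp_rw [chi_torusSum, Finset.mul_sum]
  rw [Finset.sum_comm]
  refine Finset.sum_eq_zero fun t _ => ?_
  by_cases ht : Algebra.adjoin k {(t : K)} = ⊤
  · have h1 := S.sum_chi_of_mul_chi_of g (torus k K t)
    have h2 : IsEmpty {z : K ≃ₗ[k] K // g * z * torus k K t = z} :=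
      ⟨fun z => adjoin_ne_top_of_stable z.2 hX hX' hg ht⟩
    rw [Nat.card_of_isEmpty, Nat.cast_zero] at h1
    calc _ = (Nat.card Kˣ : R)⁻¹ * h t * ∑ l, S.chi l (MonoidAlgebra.of R _ g) *
          S.chi l (MonoidAlgebra.of R _ (torus k K t)) := by
          rw [Finset.mul_sum]; exact Finset.sum_congr rfl fun l _ => by ring
      _ = 0 := by rw [h1, mul_zero]
  · simp [hh t ht]

theorem torusSum_sub (f h : Kˣ → R) : torusSum k (f - h) = torusSum k f - torusSum k h := by
  have : Fintype Kˣ := Fintype.ofFinite _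
  simp [torusSum, finsum_eq_sum_of_fintype, sub_smul, Finset.sum_sub_distrib, smul_sub]

variable [CharZero R]

theorem sum_chi_torusSum_mul_chi_torusSum [Fintype Kˣ] [Fintype (K ≃ₐ[k] K)] (f h : Kˣ → R)
    (hh : ∀ t : Kˣ, Algebra.adjoin k {(t : K)} ≠ ⊤ → h t = 0) :
    ∑ l, S.chi l (torusSum k f) * S.chi l (torusSum k h) =
      ∑ ψ : K ≃ₐ[k] K, (Nat.card Kˣ : R)⁻¹ * ∑ t, h t * f (Units.map (ψ : K →* K) t)⁻¹ := by
  classical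
  have hN : (Nat.card Kˣ : R) ≠ 0 := by exact_mod_cast Nat.card_pos.ne'
  simp_rw [chi_torusSum, ← Finset.mul_sum]
  calc _ = ∑ l, ∑ s, ∑ t, (Nat.card Kˣ : R)⁻¹ * ((Nat.card Kˣ : R)⁻¹ * (f s * h t *
        (S.chi l (MonoidAlgebra.of R _ (torus k K s)) *
          S.chi l (MonoidAlgebra.of R _ (torus k K t))))) := by
        refine Finset.sum_congr rfl fun l _ => ?_
        rw [mul_mul_mul_comm, Finset.sum_mul_sum, Finset.mul_sum]
        refine Finset.sum_congr rfl fun s _ => ?_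
        rw [Finset.mul_sum]
        exact Finset.sum_congr rfl fun t _ => by ring
    _ = ∑ t, ∑ s, ∑ l, (Nat.card Kˣ : R)⁻¹ * ((Nat.card Kˣ : R)⁻¹ * (f s * h t *
        (S.chi l (MonoidAlgebra.of R _ (torus k K s)) *
          S.chi l (MonoidAlgebra.of R _ (torus k K t))))) := by
        rw [Finset.sum_comm, Finset.sum_comm]
        simp_rw [Finset.sum_comm (s := (Finset.univ : Finset (Fin S.num)))]
        rw [Finset.sum_comm]
    _ = ∑ t, (Nat.card Kˣ : R)⁻¹ * (h t * ∑ ψ : K ≃ₐ[k] K, f (Units.map (ψ : K →* K) t)⁻¹) := by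
        refine Finset.sum_congr rfl fun t _ => ?_
        simp_rw [← Finset.mul_sum, S.sum_chi_of_mul_chi_of]
        congr 1
        by_cases ht : Algebra.adjoin k {(t : K)} = ⊤
        · have hc : ∀ s : Kˣ, (Nat.card {z : K ≃ₗ[k] K // torus k K s * z * torus k K t = z} : R) =
              Nat.card Kˣ * ∑ ψ : K ≃ₐ[k] K, if s = (Units.map (ψ : K →* K) t)⁻¹ then 1 else 0 :=
            fun s => by
              rw [card_intertwiner s t ht, Nat.cast_mul, Finset.sum_boole, Nat.card_eq_fintype_card
                (α := {ψ : K ≃ₐ[k] K // Units.map (ψ : K →* K) t = s⁻¹}), Fintype.card_subtype]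
              simp_rw [eq_inv_iff_mul_eq_one, mul_comm]
          simp_rw [hc, Finset.mul_sum]
          rw [Finset.sum_comm]
          refine Finset.sum_congr rfl fun ψ _ => ?_
          rw [Finset.sum_eq_single (Units.map (ψ : K →* K) t)⁻¹ (fun s _ hs => by simp [hs])
            (by simp)]
          simp only [if_true]
          field_simp
        · simp [hh t ht]
    _ = _ := by
        simp_rw [Finset.mul_sum]
        rw [Finset.sum_comm]

theorem sum_mul_inv_eq [Fintype Kˣ] (α β : Kˣ →* Rˣ) [Decidable (α = β)] :
    (Nat.card Kˣ : R)⁻¹ * ∑ t, ((β t)⁻¹ : Rˣ) * (α t : R) = if α = β then 1 else 0 := by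
  have hN : (Nat.card Kˣ : R) ≠ 0 := by exact_mod_cast Nat.card_pos.ne'
  have h2 : ∀ t, ((Units.coeHom R).comp (α * β⁻¹)) t = ((β t)⁻¹ : Rˣ) * (α t : R) := fun t => by
    simp [mul_comm]
  simp_rw [← h2]
  split_ifs with h
  · rw [Nat.card_eq_fintype_card] at hN ⊢
    simp [h, hN]
  · rw [sum_hom_units_eq_zero _ fun h3 => h ?_, mul_zero]
    rw [← mul_inv_eq_one]
    ext t
    simpa using DFunLike.congr_fun h3 t

/-- The element of the group algebra projecting to the `α`-isotypic part. -/
noncomputable def torusIdem (k : Type) {K R : Type} [Field k] [Field K] [Algebra k K] [Finite K]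
    [Field R] (α : Kˣ →* Rˣ) : MonoidAlgebra R (K ≃ₗ[k] K) :=
  torusSum k fun t => ((α t)⁻¹ : Rˣ)

theorem torusIdem_mul_self (α : Kˣ →* Rˣ) : torusIdem k α * torusIdem k α = torusIdem k α := by
  have : Fintype Kˣ := Fintype.ofFinite _
  have hN : (Nat.card Kˣ : R) ≠ 0 := by exact_mod_cast Nat.card_pos.ne'
  have h1 : ∀ s, MonoidAlgebra.of R _ (torus k K s) * torusIdem k α =
      (α s : R) • torusIdem k α := fun s => by
    simp_rw [torusIdem, torusSum, finsum_eq_sum_of_fintype, mul_smul_comm, Finset.mul_sum,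
      mul_smul_comm, ← map_mul]
    rw [smul_comm]
    congr 1
    rw [Finset.smul_sum]
    refine Fintype.sum_equiv (Equiv.mulLeft s) _ _ fun t => ?_
    simp only [map_mul, _root_.mul_inv_rev, Units.val_mul, smul_smul, Equiv.coe_mulLeft]
    rw [mul_left_comm, Units.mul_inv, mul_one]
  have h2 : torusIdem k α = (Nat.card Kˣ : R)⁻¹ •
      ∑ t, ((α t)⁻¹ : Rˣ).val • MonoidAlgebra.of R _ (torus k K t) := by
    rw [torusIdem, torusSum, finsum_eq_sum_of_fintype]
  conv_lhs => enter [1]; rw [h2]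
  simp_rw [smul_mul_assoc, Finset.sum_mul, smul_mul_assoc, h1, smul_smul]
  simp [← Nat.card_eq_fintype_card, ← Nat.cast_smul_eq_nsmul R, smul_smul, hN]

/-- The number of Galois automorphisms carrying a character to another one. -/
noncomputable def galoisCount (k : Type) {K R : Type} [Field k] [Field K] [Algebra k K] [Field R]
    (α β : Kˣ →* Rˣ) : ℕ :=
  Nat.card {ψ : K ≃ₐ[k] K // α.comp (Units.map (ψ : K →* K)) = β}

theorem sum_chi_torusIdem (α γ β δ : Kˣ →* Rˣ)
    (h : ∀ t : Kˣ, Algebra.adjoin k {(t : K)} ≠ ⊤ → β t = δ t) :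
    ∑ l, (S.chi l (torusIdem k α) - S.chi l (torusIdem k γ)) *
      (S.chi l (torusIdem k β) - S.chi l (torusIdem k δ)) =
      ((galoisCount k α β - galoisCount k α δ - galoisCount k γ β + galoisCount k γ δ : ℤ) : R) := by
  classical
  have : Fintype Kˣ := Fintype.ofFinite _
  have : Fintype (K ≃ₐ[k] K) := Fintype.ofFinite _
  have hc : ∀ α β : Kˣ →* Rˣ, galoisCount k α β =
      (Finset.univ.filter fun ψ : K ≃ₐ[k] K => α.comp (Units.map (ψ : K →* K)) = β).card :=
    fun α β => by rw [galoisCount, Nat.card_eq_fintype_card, Fintype.card_subtype]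
  have key : ∀ α : Kˣ →* Rˣ,
      ∑ l, S.chi l (torusIdem k α) * (S.chi l (torusIdem k β) - S.chi l (torusIdem k δ)) =
        (galoisCount k α β : R) - galoisCount k α δ := fun α => by
    simp_rw [torusIdem, ← map_sub, ← torusSum_sub]
    rw [sum_chi_torusSum_mul_chi_torusSum S _ _ fun t ht => by simp [h t ht], hc, hc,
      ← Finset.sum_boole, ← Finset.sum_boole, ← Finset.sum_sub_distrib]
    refine Finset.sum_congr rfl fun ψ _ => ?_
    rw [← sum_mul_inv_eq, ← sum_mul_inv_eq, ← mul_sub, ← Finset.sum_sub_distrib]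
    congr 1
    refine Finset.sum_congr rfl fun t _ => ?_
    simp [sub_mul]
  simp_rw [sub_mul, Finset.sum_sub_distrib, key]
  push_cast
  ring

end Orthogonality

end RegularTorus

namespace RegularTorus

open MatrixSplitting

/-- An integral vector of norm two orthogonal to a positive vector is the difference of two basis
vectors. -/
theorem exists_eq_sub_of_sum_sq_eq_two {I : Type} [Fintype I] [DecidableEq I] (D s : I → ℤ)
    (hs : ∀ i, 0 < s i) (h2 : ∑ i, D i * D i = 2) (h0 : ∑ i, s i * D i = 0) :
    ∃ i j, i ≠ j ∧ ∀ l, D l = (if l = i then 1 else 0) - (if l = j then 1 else 0) := by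
  have key : ∀ E : I → ℤ, ∑ i, E i * E i = 2 → ∑ i, s i * E i = 0 → ∃ i, 0 < E i := by
    intro E hE hE0
    by_contra! hneg
    rw [Finset.sum_eq_zero_iff_of_nonpos fun i _ =>
      mul_nonpos_of_nonneg_of_nonpos (hs i).le (hneg i)] at hE0
    have hz : ∀ i, E i = 0 := fun i =>
      (mul_eq_zero.1 (hE0 i (Finset.mem_univ i))).resolve_left (hs i).ne'
    simp [hz] at hE
  obtain ⟨i, hi⟩ := key D h2 h0
  obtain ⟨j, hj⟩ := key (-D) (by simpa using h2) (by simpa using h0)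
  simp only [Pi.neg_apply, Left.neg_pos_iff] at hj
  have hij : j ≠ i := fun h => by rw [h] at hj; omega
  have hj' : j ∈ Finset.univ.erase i := by simp [hij]
  rw [← Finset.add_sum_erase _ _ (Finset.mem_univ i), ← Finset.add_sum_erase _ _ hj'] at h2
  have hnn : 0 ≤ ∑ l ∈ (Finset.univ.erase i).erase j, D l * D l :=
    Finset.sum_nonneg fun l _ => mul_self_nonneg _
  have hDi : D i = 1 := by nlinarith
  have hDj : D j = -1 := by nlinarith
  rw [hDi, hDj] at h2
  have hsum : ∑ l ∈ (Finset.univ.erase i).erase j, D l * D l = 0 := by omega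
  rw [Finset.sum_eq_zero_iff_of_nonneg fun l _ => mul_self_nonneg _] at hsum
  refine ⟨i, j, hij.symm, fun l => ?_⟩
  by_cases hli : l = i
  · subst hli; simp [hDi, hij.symm]
  by_cases hlj : l = j
  · subst hlj; simp [hDj, hij]
  simpa [hli, hlj] using hsum l (by simp [hli, hlj])

variable {k K : Type} [Field k] [Field K] [Algebra k K] {R : Type} [Field R]

theorem galoisCount_eq {θ : Fin 3 → (Kˣ →* Rˣ)}
    (hθ : ∀ i j (ψ : K ≃ₐ[k] K), (∀ x, θ i (Units.map (ψ : K →* K) x) = θ j x) → i = j ∧ ψ = 1)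
    (i j : Fin 3) : galoisCount k (θ i) (θ j) = if i = j then 1 else 0 := by
  rw [galoisCount]
  split_ifs with h
  · subst h
    rw [Nat.card_eq_one_iff_unique]
    refine ⟨⟨fun ψ ψ' => Subtype.ext ?_⟩, ⟨1, MonoidHom.ext fun x => ?_⟩⟩
    · rw [(hθ i i ψ.1 (DFunLike.congr_fun ψ.2)).2, (hθ i i ψ'.1 (DFunLike.congr_fun ψ'.2)).2]
    · exact congrArg (θ i) (Units.ext rfl)
  · have : IsEmpty {ψ : K ≃ₐ[k] K // (θ i).comp (Units.map (ψ : K →* K)) = θ j} :=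
      ⟨fun ψ => h (hθ i j ψ.1 (DFunLike.congr_fun ψ.2)).1⟩
    exact Nat.card_of_isEmpty

variable [Finite K] [CharZero R]

theorem exists_natCast_chi_torusIdem (S : MatrixSplitting R (MonoidAlgebra R (K ≃ₗ[k] K)))
    (α : Kˣ →* Rˣ) : ∃ X : Fin S.num → ℕ, ∀ l, S.chi l (torusIdem k α) = X l := by
  choose X hX using fun l => (S.chi_natCast l (torusIdem_mul_self (k := k) α)).1
  exact ⟨X, hX⟩

/-- Three characters of the torus in general position, equal on nongenerating elements, give three
irreducible representations whose characters agree on elements with a stable subspace. -/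
theorem exists_triple (S : MatrixSplitting R (MonoidAlgebra R (K ≃ₗ[k] K)))
    (hK : 2 ≤ Module.finrank k K) (θ : Fin 3 → (Kˣ →* Rˣ))
    (hθ : ∀ x : Kˣ, Algebra.adjoin k {(x : K)} ≠ ⊤ → ∀ i j, θ i x = θ j x)
    (hθ' : ∀ i j (ψ : K ≃ₐ[k] K), (∀ x, θ i (Units.map (ψ : K →* K) x) = θ j x) → i = j ∧ ψ = 1) :
    ∃ a : Fin 3 → Fin S.num, Function.Injective a ∧
      (∀ (g : K ≃ₗ[k] K) (X : Submodule k K), X ≠ ⊥ → X ≠ ⊤ → (∀ v ∈ X, g v ∈ X) →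
        ∀ x y, S.chi (a x) (MonoidAlgebra.of R _ g) = S.chi (a y) (MonoidAlgebra.of R _ g)) ∧
      ∀ l, S.chi l (torusIdem k (θ 0)) - S.chi l (torusIdem k (θ 1)) =
        (if l = a 0 then 1 else 0) - (if l = a 1 then 1 else 0) := by
  choose X hX using fun i => exists_natCast_chi_torusIdem S (θ i)
  let D : Fin 3 → Fin S.num → ℤ := fun j l => X 0 l - X j l
  have hD : ∀ j l, S.chi l (torusIdem k (θ 0)) - S.chi l (torusIdem k (θ j)) = (D j l : R) :=
    fun j l => by simp [hX, D]
  have hpair : ∀ i j, ∑ l, D i l * D j l =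
      galoisCount k (θ 0) (θ 0) - galoisCount k (θ 0) (θ j) - galoisCount k (θ i) (θ 0) +
        galoisCount k (θ i) (θ j) := fun i j => by
    have h := sum_chi_torusIdem S (θ 0) (θ i) (θ 0) (θ j) fun t ht => hθ t ht 0 j
    simp_rw [hD] at h
    exact_mod_cast h
  have hred : ∀ (j) (g : K ≃ₗ[k] K) (Y : Submodule k K), Y ≠ ⊥ → Y ≠ ⊤ → (∀ v ∈ Y, g v ∈ Y) →
      ∑ l, S.chi l (MonoidAlgebra.of R _ g) * (D j l : R) = 0 := fun j g Y hY hY' hg => by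
    have h := sum_chi_of_mul_chi_torusSum_eq_zero S
      ((fun t => ((θ 0 t)⁻¹ : Rˣ).val) - fun t => ((θ j t)⁻¹ : Rˣ).val)
      (fun t ht => by simp [hθ t ht 0 j]) hY hY' hg
    simp_rw [torusSum_sub, map_sub] at h
    simp_rw [← hD]
    exact h
  have hsize : ∀ j, ∑ l, (S.size l : ℤ) * D j l = 0 := fun j => by
    have h := hred j 1 (Submodule.span k {1}) (by simp) (fun htop => ?_) fun v hv => hv
    · simp_rw [map_one, S.chi_apply, map_one, Matrix.trace_one, Fintype.card_fin] at h
      exact_mod_cast h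
    · have h1 := finrank_span_singleton (K := k) (one_ne_zero (α := K))
      rw [htop, finrank_top] at h1
      omega
  have hpos : ∀ l, 0 < (S.size l : ℤ) := fun l => by
    have := (S.size_ne l).ne
    omega
  simp_rw [galoisCount_eq hθ'] at hpair
  obtain ⟨i, j, hij, hDij⟩ := exists_eq_sub_of_sum_sq_eq_two (D 1) (fun l => S.size l) hpos
    (by rw [hpair]; decide) (hsize 1)
  obtain ⟨i', j', hij', hDij'⟩ := exists_eq_sub_of_sum_sq_eq_two (D 2) (fun l => S.size l) hpos
    (by rw [hpair]; decide) (hsize 2)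
  have h12 := hpair 1 2
  simp_rw [hDij, hDij'] at h12
  have hr1 : ∀ (g : K ≃ₗ[k] K) (Y : Submodule k K), Y ≠ ⊥ → Y ≠ ⊤ → (∀ v ∈ Y, g v ∈ Y) →
      S.chi i (MonoidAlgebra.of R _ g) = S.chi j (MonoidAlgebra.of R _ g) := fun g Y h h' hg => by
    have := hred 1 g Y h h' hg
    simp_rw [hDij] at this
    simpa [mul_sub, Finset.sum_sub_distrib, sub_eq_zero] using this
  have hr2 : ∀ (g : K ≃ₗ[k] K) (Y : Submodule k K), Y ≠ ⊥ → Y ≠ ⊤ → (∀ v ∈ Y, g v ∈ Y) →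
      S.chi i' (MonoidAlgebra.of R _ g) = S.chi j' (MonoidAlgebra.of R _ g) := fun g Y h h' hg => by
    have := hred 2 g Y h h' hg
    simp_rw [hDij'] at this
    simpa [mul_sub, Finset.sum_sub_distrib, sub_eq_zero] using this
  have hfin : ∀ m, m ≠ i → m ≠ j → (∀ (g : K ≃ₗ[k] K) (Y : Submodule k K), Y ≠ ⊥ → Y ≠ ⊤ →
      (∀ v ∈ Y, g v ∈ Y) →
      S.chi i (MonoidAlgebra.of R _ g) = S.chi m (MonoidAlgebra.of R _ g)) →
      ∃ a : Fin 3 → Fin S.num, Function.Injective a ∧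
      (∀ (g : K ≃ₗ[k] K) (X : Submodule k K), X ≠ ⊥ → X ≠ ⊤ → (∀ v ∈ X, g v ∈ X) →
        ∀ x y, S.chi (a x) (MonoidAlgebra.of R _ g) = S.chi (a y) (MonoidAlgebra.of R _ g)) ∧
      ∀ l, S.chi l (torusIdem k (θ 0)) - S.chi l (torusIdem k (θ 1)) =
        (if l = a 0 then 1 else 0) - (if l = a 1 then 1 else 0) := fun m hmi hmj hm => by
    refine ⟨![i, j, m], fun x y => ?_, fun g Y h h' hg x y => ?_, fun l => ?_⟩
    · fin_cases x <;> fin_cases y <;> simp [hij, hij.symm, hmi, hmj, hmi.symm, hmj.symm]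
    · have key : ∀ x, S.chi (![i, j, m] x) (MonoidAlgebra.of R _ g) =
          S.chi i (MonoidAlgebra.of R _ g) := fun x => by
        fin_cases x
        · rfl
        · exact (hr1 g Y h h' hg).symm
        · exact (hm g Y h h' hg).symm
      rw [key x, key y]
    · rw [hD, hDij]
      push_cast
      rfl
  have hinner : ((if i' = i then 1 else 0) - (if j' = i then 1 else 0) -
      (if i' = j then 1 else 0) + (if j' = j then 1 else 0) : ℤ) = 1 := by
    simp only [mul_sub, mul_ite, mul_one, mul_zero, Finset.sum_sub_distrib, Finset.sum_ite_eq',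
      Finset.mem_univ, if_true] at h12
    refine Eq.trans ?_ h12
    ring
  by_cases hii : i' = i
  · subst hii
    exact hfin j' hij'.symm (fun h => by simp [h, hij, hij.symm] at hinner) hr2
  · have hjj : j' = j := by
      by_contra hjj
      simp only [hii, hjj, if_false] at hinner
      split_ifs at hinner <;> omega
    subst hjj
    exact hfin i' hii hij' fun g Y h h' hg => (hr1 g Y h h' hg).trans (hr2 g Y h h' hg).symm

end RegularTorus

namespace RegularTorus

open MatrixSplitting

variable {k K : Type} [Field k] [Field K] [Algebra k K] (φ : K ≃+* K) (σ : k ≃+* k)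
  (hφ : ∀ c, φ (algebraMap k K c) = algebraMap k K (σ c))

/-- Conjugation by a semilinear automorphism. -/
def semilinearConj : (K ≃ₗ[k] K) →* (K ≃ₗ[k] K) where
  toFun g :=
    { (φ.symm.toAddEquiv.trans g.toAddEquiv).trans φ.toAddEquiv with
      map_smul' := fun c v => by
        change φ (g (φ.symm (c • v))) = c • φ (g (φ.symm v))
        have h : φ.symm (c • v) = σ.symm c • φ.symm v := by
          rw [RingEquiv.symm_apply_eq, Algebra.smul_def, Algebra.smul_def, map_mul, hφ]
          simp
        rw [h, map_smul, Algebra.smul_def, Algebra.smul_def, map_mul, hφ]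
        simp }
  map_one' := LinearEquiv.ext fun v => φ.apply_symm_apply v
  map_mul' g h := LinearEquiv.ext fun v => by
    change φ (g (h (φ.symm v))) = φ (g (φ.symm (φ (h (φ.symm v)))))
    rw [φ.symm_apply_apply]

theorem semilinearConj_apply (g : K ≃ₗ[k] K) (v : K) :
    semilinearConj φ σ hφ g v = φ (g (φ.symm v)) := rfl

theorem semilinearConj_torus (t : Kˣ) :
    semilinearConj φ σ hφ (torus k K t) = torus k K (Units.map (φ : K →* K) t) :=
  LinearEquiv.ext fun v => by simp [semilinearConj_apply, torus_apply]

theorem semilinearConj_injective : Function.Injective (semilinearConj φ σ hφ) := fun g h hgh =>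
  LinearEquiv.ext fun v => by
    have h1 := LinearEquiv.congr_fun hgh (φ v)
    rw [semilinearConj_apply, semilinearConj_apply, φ.symm_apply_apply] at h1
    exact φ.injective h1

variable {R : Type} [Field R]

/-- The twist by an endomorphism `f` of the contragredient of a matrix representation. -/
noncomputable def dualTwist {G : Type} [Group G] {d : ℕ}
    (ρ : MonoidAlgebra R G →ₐ[R] Matrix (Fin d) (Fin d) R)
    (f : G →* G) : MonoidAlgebra R G →ₐ[R] Matrix (Fin d) (Fin d) R :=
  MonoidAlgebra.lift R _ G
    { toFun := fun g => (ρ (MonoidAlgebra.of R _ (f g)⁻¹))ᵀ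
      map_one' := by rw [map_one, inv_one, map_one, map_one, Matrix.transpose_one]
      map_mul' := fun g h => by
        rw [map_mul, _root_.mul_inv_rev, map_mul, map_mul, Matrix.transpose_mul] }

theorem dualTwist_of {G : Type} [Group G] {d : ℕ}
    (ρ : MonoidAlgebra R G →ₐ[R] Matrix (Fin d) (Fin d) R) (f : G →* G) (g : G) :
    dualTwist ρ f (MonoidAlgebra.of R _ g) = (ρ (MonoidAlgebra.of R _ (f g)⁻¹))ᵀ := by
  rw [dualTwist, MonoidAlgebra.lift_of]
  rfl

theorem dualTwist_surjective {G : Type} [Group G] {d : ℕ}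
    (ρ : MonoidAlgebra R G →ₐ[R] Matrix (Fin d) (Fin d) R) (hρ : Function.Surjective ρ)
    (f : G →* G) (hf : Function.Surjective f) : Function.Surjective (dualTwist ρ f) := by
  have key : ∀ y, (ρ y)ᵀ ∈ LinearMap.range (dualTwist ρ f).toLinearMap := fun y => by
    induction y using MonoidAlgebra.induction_on with
    | of g =>
      obtain ⟨x, hx⟩ := hf g⁻¹
      exact ⟨MonoidAlgebra.of R _ x, (dualTwist_of ρ f x).trans (by rw [hx, inv_inv])⟩
    | add y z hy hz =>
      rw [map_add, Matrix.transpose_add]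
      exact Submodule.add_mem _ hy hz
    | smul c y hy =>
      rw [map_smul, Matrix.transpose_smul]
      exact Submodule.smul_mem _ c hy
  intro m
  obtain ⟨y, hy⟩ := hρ mᵀ
  obtain ⟨x, hx⟩ := key y
  exact ⟨x, by rw [← Matrix.transpose_transpose m, ← hy]; exact hx⟩

variable [Finite K]

theorem trace_dualTwist_torusIdem (S : MatrixSplitting R (MonoidAlgebra R (K ≃ₗ[k] K)))
    (l : Fin S.num) (α : Kˣ →* Rˣ) :
    (dualTwist (S.rep l) (semilinearConj φ σ hφ) (torusIdem k α)).trace =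
      S.chi l (torusIdem k (α.comp (Units.map (φ.symm : K →* K)))⁻¹) := by
  have : Fintype Kˣ := Fintype.ofFinite _
  have h := chi_torusSum ((Matrix.traceLinearMap (Fin (S.size l)) R R) ∘ₗ
    (dualTwist (S.rep l) (semilinearConj φ σ hφ)).toLinearMap) fun t : Kˣ => ((α t)⁻¹ : Rˣ).val
  rw [torusIdem, torusIdem]
  refine Eq.trans h ?_
  rw [chi_torusSum]
  congr 1
  let e : Kˣ ≃ Kˣ := (Units.mapEquiv (φ : K ≃* K)).toEquiv.trans (Equiv.inv Kˣ)
  refine Fintype.sum_equiv e _ _ fun t => ?_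
  have he : e t = (Units.map (φ : K →* K) t)⁻¹ := rfl
  have h1 : Units.map (φ.symm : K →* K) (Units.map (φ : K →* K) t) = t := Units.ext (by simp)
  rw [he, MonoidHom.inv_apply, MonoidHom.comp_apply, map_inv, h1, map_inv α, inv_inv]
  congr 1
  change (dualTwist (S.rep l) (semilinearConj φ σ hφ)
    (MonoidAlgebra.of R _ (torus k K t))).trace = _
  rw [dualTwist_of, Matrix.trace_transpose, semilinearConj_torus, ← map_inv (torus k K), chi_apply]

/-- One of the two representations separated by the characters `θ 0` and `θ 1` is isomorphic to the
twist of its contragredient, provided `φ` inverts `θ 0`. -/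
theorem exists_equiv_dualTwist [CharZero R]
    (S : MatrixSplitting R (MonoidAlgebra R (K ≃ₗ[k] K))) (hσ : ∀ c, σ (σ c) = c)
    (θ : Fin 3 → (Kˣ →* Rˣ))
    (hθ : ∀ x : Kˣ, Algebra.adjoin k {(x : K)} ≠ ⊤ → ∀ i j, θ i x = θ j x)
    (hθ' : ∀ i j (ψ : K ≃ₐ[k] K), (∀ x, θ i (Units.map (ψ : K →* K) x) = θ j x) → i = j ∧ ψ = 1)
    (hθ0 : ∀ x, θ 0 (Units.map (φ : K →* K) x) = (θ 0 x)⁻¹) (a : Fin 3 → Fin S.num)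
    (ha : ∀ l, S.chi l (torusIdem k (θ 0)) - S.chi l (torusIdem k (θ 1)) =
        (if l = a 0 then 1 else 0) - (if l = a 1 then 1 else 0)) :
    ∃ x, ∃ P : (Fin (S.size (a x)) → R) ≃ₗ[R] (Fin (S.size (a x)) → R),
      ∀ g w, P (S.rep (a x) g *ᵥ w) =
        dualTwist (S.rep (a x)) (semilinearConj φ σ hφ) g *ᵥ P w := by
  have hsurj : Function.Surjective (semilinearConj φ σ hφ) :=
    Finite.injective_iff_surjective.1 (semilinearConj_injective φ σ hφ)
  have hex : ∀ l, ∃ i, ∃ P : (Fin (S.size i) → R) ≃ₗ[R] (Fin (S.size l) → R),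
      ∀ g w, P (S.rep i g *ᵥ w) =
        dualTwist (S.rep l) (semilinearConj φ σ hφ) g *ᵥ P w := fun l => by
    have := S.size_ne l
    exact S.exists_equiv _ (dualTwist_surjective _ (S.rep_surjective l) _ hsurj)
  choose i P hP using hex
  let τ : (Kˣ →* Rˣ) → (Kˣ →* Rˣ) := fun α => (α.comp (Units.map (φ.symm : K →* K)))⁻¹
  have hτ : ∀ l α, S.chi l (torusIdem k (τ α)) = S.chi (i l) (torusIdem k α) := fun l α => by
    rw [← trace_eq_chi S _ (i l) (P l) (hP l), trace_dualTwist_torusIdem]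
  have hτ0 : τ (θ 0) = θ 0 := by
    ext x
    have h := hθ0 (Units.map (φ.symm : K →* K) x)
    rw [show Units.map (φ : K →* K) (Units.map (φ.symm : K →* K) x) = x from
      Units.ext (by simp)] at h
    simp [τ, h]
  have hτ1 : galoisCount k (τ (θ 1)) (θ 0) = 0 := by
    have : IsEmpty {ψ : K ≃ₐ[k] K // (τ (θ 1)).comp (Units.map (ψ : K →* K)) = θ 0} := by
      refine ⟨fun ψ => ?_⟩
      have hs : ∀ c, φ.symm (algebraMap k K c) = algebraMap k K (σ c) := fun c => by
        rw [RingEquiv.symm_apply_eq, hφ, hσ]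
      let ψ' : K ≃ₐ[k] K := AlgEquiv.ofRingEquiv (f := (φ.symm.trans ψ.1.toRingEquiv).trans φ.symm)
        fun c => by
          change φ.symm (ψ.1 (φ.symm (algebraMap k K c))) = _
          rw [hs, AlgEquiv.commutes, hs, hσ]
      have h := (hθ' 1 0 ψ' fun x => ?_).1
      · exact absurd h (by decide)
      · have h1 := DFunLike.congr_fun ψ.2 (Units.map (φ.symm : K →* K) x)
        have h2 := hθ0 (Units.map (φ.symm : K →* K) x)
        rw [show Units.map (φ : K →* K) (Units.map (φ.symm : K →* K) x) = x from
          Units.ext (by simp)] at h2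
        rw [h2, ← h1]
        simp only [τ, MonoidHom.comp_apply, MonoidHom.inv_apply, inv_inv]
        exact congrArg (θ 1) (Units.ext rfl)
    exact Nat.card_of_isEmpty
  have hsum := sum_chi_torusIdem S (τ (θ 0)) (τ (θ 1)) (θ 0) (θ 1) fun t ht => hθ t ht 0 1
  have hdiff : ∀ l, S.chi l (torusIdem k (τ (θ 0))) - S.chi l (torusIdem k (τ (θ 1))) =
      (if i l = a 0 then 1 else 0) - (if i l = a 1 then 1 else 0) := fun l => by
    rw [hτ, hτ, ha]
  simp_rw [hdiff, ha] at hsum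
  rw [hτ1, hτ0, galoisCount_eq hθ', galoisCount_eq hθ'] at hsum
  simp only [mul_sub, mul_ite, mul_one, mul_zero, Finset.sum_sub_distrib, Finset.sum_ite_eq',
    Finset.mem_univ, if_true] at hsum
  have hsum' : ((if i (a 0) = a 0 then 1 else 0) - (if i (a 0) = a 1 then 1 else 0) -
      ((if i (a 1) = a 0 then 1 else 0) - (if i (a 1) = a 1 then 1 else 0)) : ℤ) =
      1 + galoisCount k (τ (θ 1)) (θ 1) := by
    have : ((0 : Fin 3) = 1) = False := by simp
    simp only [this, if_false] at hsum
    push_cast at hsum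
    exact_mod_cast hsum
  have hor : i (a 0) = a 0 ∨ i (a 1) = a 1 := by
    by_contra! h
    simp only [h.1, h.2, if_false] at hsum'
    split_ifs at hsum' <;> omega
  have hfin : ∀ x, i (a x) = a x → ∃ Q : (Fin (S.size (a x)) → R) ≃ₗ[R] (Fin (S.size (a x)) → R),
      ∀ g w, Q (S.rep (a x) g *ᵥ w) =
        dualTwist (S.rep (a x)) (semilinearConj φ σ hφ) g *ᵥ Q w := fun x hx => by
    have h : ∃ Q : (Fin (S.size (i (a x))) → R) ≃ₗ[R] (Fin (S.size (a x)) → R),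
      ∀ g w, Q (S.rep (i (a x)) g *ᵥ w) =
        dualTwist (S.rep (a x)) (semilinearConj φ σ hφ) g *ᵥ Q w := ⟨P (a x), hP (a x)⟩
    rwa [hx] at h
  exact hor.elim (fun h => ⟨0, hfin 0 h⟩) fun h => ⟨1, hfin 1 h⟩

end RegularTorus

namespace MatrixRepresentation

variable {R : Type} [Field R] {G : Type} [Group G] {d : ℕ}

/-- The representation attached to a matrix representation of the group algebra. -/
noncomputable def matrixRep (ψ : MonoidAlgebra R G →ₐ[R] Matrix (Fin d) (Fin d) R) :
    Representation R G (Fin d → R) :=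
  (Matrix.toLinAlgEquiv' : Matrix (Fin d) (Fin d) R ≃ₐ[R] _).toAlgHom.toMonoidHom.comp
    (ψ.toMonoidHom.comp (MonoidAlgebra.of R G))

theorem matrixRep_apply (ψ : MonoidAlgebra R G →ₐ[R] Matrix (Fin d) (Fin d) R) (g : G)
    (v : Fin d → R) : matrixRep ψ g v = ψ (MonoidAlgebra.of R G g) *ᵥ v := rfl

theorem isIrreducibleRep_comp {H : Type} [Group H] {V : Type} [AddCommGroup V] [Module R V]
    {ρ : Representation R G V} (hρ : IsIrreducibleRep ρ) {e : H →* G}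
    (he : Function.Surjective e) : IsIrreducibleRep (ρ.comp e) := by
  refine ⟨hρ.1, fun W hW => hρ.2 W fun g v hv => ?_⟩
  obtain ⟨h, rfl⟩ := he g
  exact hW h v hv

theorem isIrreducibleRep_matrixRep [NeZero d]
    {ψ : MonoidAlgebra R G →ₐ[R] Matrix (Fin d) (Fin d) R} (hψ : Function.Surjective ψ) :
    IsIrreducibleRep (matrixRep ψ) := by
  refine ⟨bot_ne_top, fun W hW => or_iff_not_imp_left.2 fun hne => ?_⟩
  have hall : ∀ y : MonoidAlgebra R G, ∀ v ∈ W, ψ y *ᵥ v ∈ W := fun y => by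
    induction y using MonoidAlgebra.induction_on with
    | of g => exact fun v hv => hW g v hv
    | add x y hx hy =>
      intro v hv
      rw [map_add, Matrix.add_mulVec]
      exact W.add_mem (hx v hv) (hy v hv)
    | smul c x hx =>
      intro v hv
      rw [map_smul, Matrix.smul_mulVec]
      exact W.smul_mem c (hx v hv)
  obtain ⟨w, hw, hw0⟩ := W.ne_bot_iff.1 hne
  obtain ⟨i, hi⟩ := Function.ne_iff.1 hw0
  refine eq_top_iff.2 fun v _ => ?_
  obtain ⟨y, hy⟩ := hψ (Matrix.vecMulVec v (Pi.single i (w i)⁻¹))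
  have h := hall y w hw
  rw [hy, Matrix.vecMulVec_mulVec, single_dotProduct, inv_mul_cancel₀ hi] at h
  simpa using h

end MatrixRepresentation

namespace ParabolicInduction

variable {k : Type} [Field k] [Finite k] {n : ℕ}

/-- A representation in which every unipotent radical contains a family of elements with
vanishing sum is not a subquotient of a parabolically induced representation. -/
theorem isSupercuspidal_of_sum_eq_zero {R : Type} [Field R] [CharZero R] {V : Type}
    [AddCommGroup V] [Module R V] [Nontrivial V] (ρ : Representation R (GL (Fin n) k) V)
    (h : ∀ r, 2 ≤ r → ∀ B : Fin n → Fin r, Monotone B → Function.Surjective B →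
      ∃ (ι : Type) (_ : Fintype ι) (_ : Nonempty ι) (u : ι → parabolic k n r B),
        (∀ x (i j : Fin n), B i = B j →
          ((u x : GL (Fin n) k) : Matrix (Fin n) (Fin n) k) i j =
            (1 : Matrix (Fin n) (Fin n) k) i j) ∧
        ∀ v, ∑ x, ρ (u x) v = 0) :
    IsSupercuspidal k ρ := by
  intro r hr B hB hB' W _ _ τ hτ hsub
  obtain ⟨ι, _, _, u, hu, hsum⟩ := h r hr B hB hB'
  obtain ⟨q, hq, f, hf, hfe⟩ := hsub
  let _ : Fintype (GL (Fin n) k) := Fintype.ofFinite _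
  obtain ⟨s, hs⟩ := f.exists_rightInverse_of_surjective (LinearMap.range_eq_top.2 hf)
  let act : GL (Fin n) k → q →ₗ[R] q := fun g =>
    (inducedRep (parabolic k n r B) τ g).restrict (hq g)
  have hact : ∀ g g' w, act (g * g') w = act g (act g' w) := fun g g' w =>
    Subtype.ext (by
      change inducedRep (parabolic k n r B) τ (g * g') w.1 = _
      rw [map_mul]
      rfl)
  have hfact : ∀ g w, f (act g w) = ρ g (f w) := hfe
  have hact1 : ∀ g w x, (act g w).1.1 x = w.1.1 (x * g) := fun _ _ _ => rfl
  let S : V →ₗ[R] q := ∑ g, act g ∘ₗ s ∘ₗ ρ g⁻¹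
  have hSapp : ∀ v, S v = ∑ g, act g (s (ρ g⁻¹ v)) := fun v => by
    simp only [S, LinearMap.sum_apply, LinearMap.comp_apply]
  have hS : ∀ g v, S (ρ g v) = act g (S v) := fun g v => by
    rw [hSapp, hSapp, map_sum]
    refine (Fintype.sum_equiv (Equiv.mulLeft g) _ _ fun x => ?_).symm
    rw [Equiv.coe_mulLeft, hact, _root_.mul_inv_rev, map_mul, Module.End.mul_apply,
      ← Module.End.mul_apply (ρ g⁻¹),
      ← map_mul, inv_mul_cancel, map_one, Module.End.one_apply]
  have hfS : ∀ v, f (S v) = (Fintype.card (GL (Fin n) k) : R) • v := fun v => by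
    have : ∀ g, f (act g (s (ρ g⁻¹ v))) = v := fun g => by
      rw [hfact, ← LinearMap.comp_apply f s, hs, LinearMap.id_apply, ← Module.End.mul_apply,
        ← map_mul, mul_inv_cancel, map_one, Module.End.one_apply]
    rw [hSapp, map_sum, Finset.sum_congr rfl fun g _ => this g, Finset.sum_const,
      Finset.card_univ, Nat.cast_smul_eq_nsmul]
  have hone : ∀ v, (S v).1.1 1 = 0 := fun v => by
    have h1 : ∀ x, (S (ρ (u x) v)).1.1 1 = (S v).1.1 1 := fun x => by
      have h2 := (S v).1.2 (u x) 1
      rw [hS, hact1, one_mul, ← mul_one (u x : GL (Fin n) k), h2, hτ (u x) (hu x),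
        Module.End.one_apply]
    have h3 : (∑ x, S (ρ (u x) v)).1.1 1 = 0 := by
      rw [← map_sum, hsum, map_zero]
      rfl
    let ev : q →ₗ[R] W := (LinearMap.proj 1 ∘ₗ (indCarrier (parabolic k n r B) τ).subtype) ∘ₗ
      q.subtype
    have h4 : ev (∑ x, S (ρ (u x) v)) = (Fintype.card ι : R) • ev (S v) := by
      rw [map_sum, Finset.sum_congr rfl fun x _ => show ev _ = ev (S v) from h1 x,
        Finset.sum_const, Finset.card_univ, Nat.cast_smul_eq_nsmul]
    have h5 : (Fintype.card ι : R) • ev (S v) = 0 := h4.symm.trans h3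
    exact (smul_eq_zero.1 h5).resolve_left (Nat.cast_ne_zero.2 Fintype.card_ne_zero)
  have hzero : ∀ v, S v = 0 := fun v => Subtype.ext <| Subtype.ext <| funext fun x => by
    have := hone (ρ x v)
    rwa [hS, hact1, one_mul] at this
  obtain ⟨v, hv⟩ := exists_ne (0 : V)
  have h6 := hfS v
  rw [hzero, map_zero] at h6
  exact hv ((smul_eq_zero.1 h6.symm).resolve_left (Nat.cast_ne_zero.2 Fintype.card_ne_zero))

end ParabolicInduction

namespace FieldModel

open MatrixSplitting MatrixRepresentation

variable {k K : Type} [Field k] [Field K] [Algebra k K] {n : ℕ} (b : Module.Basis (Fin n) k K)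

/-- The identification of `GL n k` with the automorphisms of `K` given by a basis. -/
noncomputable def glEquiv : GL (Fin n) k ≃* (K ≃ₗ[k] K) :=
  (Units.mapEquiv (LinearMap.toMatrixAlgEquiv b).symm.toMulEquiv).trans
    (LinearMap.GeneralLinearGroup.generalLinearEquiv k K)

theorem repr_glEquiv (A : GL (Fin n) k) (v : K) :
    ⇑(b.repr (glEquiv b A v)) = (A : Matrix (Fin n) (Fin n) k) *ᵥ b.repr v :=
  Matrix.repr_toLin b b (A : Matrix (Fin n) (Fin n) k) v

theorem coe_eq_repr_glEquiv (A : GL (Fin n) k) (i j : Fin n) :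
    (A : Matrix (Fin n) (Fin n) k) i j = b.repr (glEquiv b A (b j)) i := by
  rw [repr_glEquiv, b.repr_self, Finsupp.single_eq_pi_single, Matrix.mulVec_single_one]
  rfl

/-- The Galois action on matrices is conjugate to conjugation by a semilinear automorphism. -/
theorem exists_glEquiv_glAut {k₀ : Type} [Field k₀] [Algebra k₀ k] (σ : k ≃ₐ[k₀] k) (φ : K ≃+* K)
    (hφ : ∀ c, φ (algebraMap k K c) = algebraMap k K (σ.toRingEquiv c)) :
    ∃ h : K ≃ₗ[k] K, ∀ A, glEquiv b (glAut k₀ k σ n A) * h =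
      h * RegularTorus.semilinearConj φ σ.toRingEquiv hφ (glEquiv b A) := by
  have : FiniteDimensional k K := Module.Basis.finiteDimensional_of_finite b
  let D : K →ₗ[k] K :=
    { toFun := fun v => b.equivFun.symm fun i => σ (b.equivFun (φ.symm v) i)
      map_add' := fun v w => by
        rw [← map_add]
        congr 1
        funext i
        simp only [map_add, Pi.add_apply]
      map_smul' := fun c v => by
        have h : φ.symm (c • v) = σ.symm c • φ.symm v := by
          rw [RingEquiv.symm_apply_eq, Algebra.smul_def, Algebra.smul_def, map_mul, hφ]
          simp
        rw [RingHom.id_apply, ← map_smul]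
        congr 1
        funext i
        rw [h, map_smul, Pi.smul_apply, Pi.smul_apply, smul_eq_mul, smul_eq_mul, map_mul,
          AlgEquiv.apply_symm_apply] }
  have hD : ∀ v, ⇑(b.repr (D v)) = fun i => σ (b.repr (φ.symm v) i) := fun v =>
    b.equivFun.apply_symm_apply _
  have hinj : Function.Injective D := fun v w hvw => by
    have h1 := congrArg (fun x => ⇑(b.repr x)) hvw
    simp only [hD] at h1
    exact φ.symm.injective (b.repr.injective (DFunLike.coe_injective
      (funext fun i => σ.injective (congrFun h1 i))))
  refine ⟨LinearEquiv.ofInjectiveEndo D hinj, fun A => LinearEquiv.ext fun v =>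
    b.repr.injective (DFunLike.coe_injective ?_)⟩
  change ⇑(b.repr (glEquiv b (glAut k₀ k σ n A) (D v))) =
    ⇑(b.repr (D (φ (glEquiv b A (φ.symm v)))))
  rw [repr_glEquiv, hD, hD, φ.symm_apply_apply]
  funext i
  rw [repr_glEquiv, Matrix.mulVec, Matrix.mulVec, dotProduct, dotProduct, map_sum]
  exact Finset.sum_congr rfl fun j _ => (map_mul σ _ _).symm

variable {R : Type} [Field R] [CharZero R] [Finite k] [Finite (K ≃ₗ[k] K)]

/-- A representation without nonzero vectors fixed by the unipotent groups is supercuspidal. -/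
theorem isSupercuspidal_matrixRep {d : ℕ} [NeZero d]
    (ψ : MonoidAlgebra R (K ≃ₗ[k] K) →ₐ[R] Matrix (Fin d) (Fin d) R)
    (hψ : ∀ L : Submodule k K, L ≠ ⊥ → L ≠ ⊤ → ψ (GroupAverage.avg R (Parahoric.unip L)) = 0) :
    IsSupercuspidal k ((matrixRep ψ).comp (glEquiv b).toMonoidHom) := by
  refine ParabolicInduction.isSupercuspidal_of_sum_eq_zero _ fun r hr B hB hB' => ?_
  let L : Submodule k K := ⨅ i : {i : Fin n // (B i : ℕ) ≠ 0}, LinearMap.ker (b.coord i.1)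
  have hL : ∀ v, v ∈ L ↔ ∀ i, (B i : ℕ) ≠ 0 → b.repr v i = 0 := fun v => by
    simp [L, Submodule.mem_iInf]
  obtain ⟨i₀, hi₀⟩ := hB' ⟨0, by omega⟩
  obtain ⟨i₁, hi₁⟩ := hB' ⟨1, by omega⟩
  have hbL : ∀ j, (B j : ℕ) = 0 → b j ∈ L := fun j hj => (hL _).2 fun i hi => by
    rw [b.repr_self, Finsupp.single_eq_of_ne]
    rintro rfl
    exact hi hj
  have hLbot : L ≠ ⊥ := fun hbot => b.ne_zero i₀ ((Submodule.mem_bot k).1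
    (hbot ▸ hbL i₀ (by rw [hi₀])))
  have hLtop : L ≠ ⊤ := fun htop => by
    have h1 : b i₁ ∈ L := htop ▸ Submodule.mem_top
    have h2 := (hL _).1 h1 i₁ (by rw [hi₁]; exact one_ne_zero)
    rw [b.repr_self, Finsupp.single_eq_same] at h2
    exact one_ne_zero h2
  have hone : ∀ i j, (1 : Matrix (Fin n) (Fin n) k) i j = b.repr (b j) i := fun i j => by
    rw [b.repr_self, Matrix.one_apply, Finsupp.single_apply]
    simp only [eq_comm]
  have hentry : ∀ s : Parahoric.unip L, ∀ i j, (B i : ℕ) ≠ 0 ∨ (B j : ℕ) = 0 →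
      ((glEquiv b).symm s : Matrix (Fin n) (Fin n) k) i j =
        (1 : Matrix (Fin n) (Fin n) k) i j := fun s i j hij => by
    obtain ⟨h1, h2⟩ := Parahoric.mem_unip.1 s.2
    rw [coe_eq_repr_glEquiv b, MulEquiv.apply_symm_apply, hone]
    rcases hij with hi | hj
    · have := (hL _).1 (h1 (b j)) i hi
      rwa [map_sub, Finsupp.sub_apply, sub_eq_zero] at this
    · rw [h2 _ (hbL j hj)]
  let _ : Fintype (Parahoric.unip L) := Fintype.ofFinite _
  refine ⟨Parahoric.unip L, inferInstance, inferInstance,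
    fun s => ⟨(glEquiv b).symm s, fun i j hij => ?_⟩, fun s i j hij => ?_, fun v => ?_⟩
  · rw [hentry s i j (Or.inl (Nat.ne_of_gt (lt_of_le_of_lt (Nat.zero_le _) hij))),
      Matrix.one_apply_ne]
    rintro rfl
    exact lt_irrefl _ hij
  · refine hentry s i j ?_
    rw [hij]
    exact (em _).symm
  · have h1 := hψ L hLbot hLtop
    rw [GroupAverage.avg, map_smul] at h1
    have h2 := (smul_eq_zero.1 h1).resolve_left
      (inv_ne_zero (Nat.cast_ne_zero.2 Nat.card_pos.ne'))
    rw [map_sum] at h2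
    have h3 : ∀ s : Parahoric.unip L,
        ((matrixRep ψ).comp (glEquiv b).toMonoidHom) ((glEquiv b).symm s) v =
          ψ (MonoidAlgebra.of R _ (s : K ≃ₗ[k] K)) *ᵥ v := fun s => by
      change matrixRep ψ (glEquiv b ((glEquiv b).symm s)) v = _
      rw [MulEquiv.apply_symm_apply, matrixRep_apply]
    rw [Finset.sum_congr rfl fun s _ => h3 s, ← Matrix.sum_mulVec, h2, Matrix.zero_mulVec]

end FieldModel

namespace FieldModel

open MatrixSplitting MatrixRepresentation

variable {k K : Type} [Field k] [Field K] [Algebra k K] {n : ℕ} (b : Module.Basis (Fin n) k K)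

variable {R : Type} [Field R]

theorem repIso_dual {k₀ : Type} [Field k₀] [Algebra k₀ k] (σ : k ≃ₐ[k₀] k) (φ : K ≃+* K)
    (hφ : ∀ c, φ (algebraMap k K c) = algebraMap k K (σ.toRingEquiv c)) {d : ℕ}
    (ψ : MonoidAlgebra R (K ≃ₗ[k] K) →ₐ[R] Matrix (Fin d) (Fin d) R)
    (P : (Fin d → R) ≃ₗ[R] (Fin d → R))
    (hP : ∀ g w, P (ψ g *ᵥ w) =
      RegularTorus.dualTwist ψ (RegularTorus.semilinearConj φ σ.toRingEquiv hφ) g *ᵥ P w) :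
    RepIso (((matrixRep ψ).comp (glEquiv b).toMonoidHom).comp (glAut k₀ k σ n))
      (Representation.dual ((matrixRep ψ).comp (glEquiv b).toMonoidHom)) := by
  obtain ⟨h, hh⟩ := exists_glEquiv_glAut b σ φ hφ
  let ρ := matrixRep ψ
  have hρ : ∀ x y v, ρ (x * y) v = ρ x (ρ y v) := fun x y v => by
    rw [map_mul, Module.End.mul_apply]
  let H : (Fin d → R) ≃ₗ[R] (Fin d → R) :=
    LinearEquiv.ofLinearMap (ρ h⁻¹) (ρ h)
      (by rw [← Module.End.mul_eq_comp, ← map_mul, inv_mul_cancel, map_one]; rfl)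
      (by rw [← Module.End.mul_eq_comp, ← map_mul, mul_inv_cancel, map_one]; rfl)
  let Q : (Fin d → R) ≃ₗ[R] Module.Dual R (Fin d → R) :=
    (dotProductEquiv R (Fin d)).trans P.dualMap
  have hQ : ∀ v w, Q v w = v ⬝ᵥ P w := fun _ _ => rfl
  refine ⟨H.trans Q, fun A v => LinearMap.ext fun w => ?_⟩
  change Q (ρ h⁻¹ (ρ (glEquiv b (glAut k₀ k σ n A)) v)) w =
    Q (ρ h⁻¹ v) (ρ (glEquiv b A⁻¹) w)
  set g := glEquiv b A with hg
  have h1 : glEquiv b (glAut k₀ k σ n A) =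
      h * RegularTorus.semilinearConj φ σ.toRingEquiv hφ g * h⁻¹ := by
    rw [← hh, mul_inv_cancel_right]
  rw [h1, ← hρ, ← mul_assoc, inv_mul_cancel_left, hρ, hQ, hQ, map_inv (glEquiv b), ← hg]
  change (ψ _ *ᵥ _) ⬝ᵥ P w = _ ⬝ᵥ P (ψ (MonoidAlgebra.of R _ g⁻¹) *ᵥ w)
  rw [hP, RegularTorus.dualTwist_of, map_inv (RegularTorus.semilinearConj _ _ _), inv_inv,
    Matrix.mulVec_transpose,
    dotProduct_comm, Matrix.dotProduct_mulVec, dotProduct_comm]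

end FieldModel

theorem exists_sigma_selfdual_supercuspidal_one (k₀ k : Type) [Field k₀] [Field k] [Algebra k₀ k]
    (σ : k ≃ₐ[k₀] k) (R : Type) [Field R] :
    ∃ (M : ModuleCat R) (ρ : Representation R (GL (Fin 1) k) ↥M),
      IsIrreducibleRep ρ ∧ IsSupercuspidal k ρ ∧
        RepIso (ρ.comp (glAut k₀ k σ 1)) ρ.dual := by
  refine ⟨ModuleCat.of R R, Representation.trivial R (GL (Fin 1) k) R,
    ⟨bot_ne_top (α := Submodule R R), fun W _ => eq_bot_or_eq_top (α := Submodule R R) W⟩,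
    fun r hr B _ hB => ?_,
    (LinearMap.ringLmapEquivSelf R R R).symm, fun g v => LinearMap.ext fun w => ?_⟩
  · have h := Fintype.card_le_of_surjective B hB
    simp only [Fintype.card_fin] at h
    omega
  · rfl

/-- In characteristic `0`, if `n` is odd then `GL n k` has a σ-selfdual
supercuspidal irreducible representation. -/
theorem exists_sigma_selfdual_supercuspidal
    (p : ℕ) [Fact p.Prime]
    (k₀ k : Type) [Field k₀] [Field k] [Fintype k₀] [Fintype k]
    [CharP k p] [Algebra k₀ k] (hquad : Module.finrank k₀ k = 2)
    (σ : k ≃ₐ[k₀] k) (hσ : σ ≠ AlgEquiv.refl)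
    (R : Type) [Field R] [IsAlgClosed R] [CharZero R]
    (n : ℕ) (hn : Odd n) :
    ∃ (M : ModuleCat R) (ρ : Representation R (GL (Fin n) k) ↥M),
      IsIrreducibleRep ρ ∧ IsSupercuspidal k ρ ∧
        RepIso (ρ.comp (glAut k₀ k σ n)) ρ.dual := by
  by_cases hn1 : n = 1
  · subst hn1
    exact exists_sigma_selfdual_supercuspidal_one k₀ k σ R
  have hn3 : 3 ≤ n := by
    obtain ⟨m, rfl⟩ := hn
    omega
  have hcard : Fintype.card k = Fintype.card k₀ ^ 2 := by
    rw [Module.card_eq_pow_finrank (K := k₀), hquad]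
  have hσσ : ∀ c, σ.toRingEquiv (σ.toRingEquiv c) = c := fun c => by
    change σ (σ c) = c
    rw [FiniteFieldTower.apply_eq_pow_card hquad σ hσ,
      FiniteFieldTower.apply_eq_pow_card hquad σ hσ,
      ← pow_mul, ← sq, ← hcard, FiniteField.pow_card]
  obtain ⟨K, _, _, _, φ, hfr, hφ, hφσ⟩ := FiniteFieldTower.exists_field p k₀ k hquad σ hσ n hn
  obtain ⟨θ, hθ, hθ', hθ0⟩ := FiniteFieldTower.exists_characters
    (Fintype.one_lt_card (α := k₀)) hn hn3 hcard hfr φ hφ R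
  have hfin : FiniteDimensional k K := Module.Finite.of_finite
  obtain ⟨S⟩ := MatrixSplitting.nonempty_monoidAlgebra (R := R) (K ≃ₗ[k] K)
  obtain ⟨a, ha, hred, hdiff⟩ := RegularTorus.exists_triple S (by omega) θ hθ hθ'
  obtain ⟨x, P, hP⟩ := RegularTorus.exists_equiv_dualTwist φ σ.toRingEquiv hφσ S hσσ θ hθ hθ' hθ0
    a hdiff
  have := S.size_ne (a x)
  let b : Module.Basis (Fin n) k K := Module.finBasisOfFinrankEq k K hfr
  refine ⟨ModuleCat.of R (Fin (S.size (a x)) → R),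
    (MatrixRepresentation.matrixRep (S.rep (a x))).comp (FieldModel.glEquiv b).toMonoidHom,
    MatrixRepresentation.isIrreducibleRep_comp
      (MatrixRepresentation.isIrreducibleRep_matrixRep (S.rep_surjective (a x)))
      (FieldModel.glEquiv b).surjective,
    FieldModel.isSupercuspidal_matrixRep b (S.rep (a x)) fun L hL hL' =>
      Parahoric.rep_avg_unip_eq_zero S a ha hred L hL hL' x,
    FieldModel.repIso_dual b σ φ hφσ (S.rep (a x)) P hP⟩
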